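/- arXiv:2212.14023 — 7 statements merged into one kernel-verified Lean document; each statement's English description precedes it below -/
import Mathlib

section
/- Let μ be a centered Gaussian measure on a finite-dimensional real vector space X and let ν be a probability measure on X whose Radon–Nikodym derivative dν/dμ is a finite product of symmetric quasi-concave nonnegative measurable functions. Then (i) ν(K) ≥ μ(K) for every symmetric convex Borel set K ⊆ X, and (ii) ∫ g dν ≤ ∫ g dμ for every nonnegative symmetric convex function g : X → ℝ≥0 that is μ-integrable. -/
open MeasureTheory ProbabilityTheory
open scoped NNReal ENNReal

noncomputable section

/-- A centered Gaussian measure on `ℝⁿ` (any finite-dimensional real vector space, up to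
isomorphism): a Borel probability measure all of whose one-dimensional pushforwards under
linear functionals are centered Gaussian (possibly degenerate).  In finite dimension every
linear functional is continuous, so we quantify over continuous linear functionals. -/
def IsCenteredGaussian {n : ℕ} (μ : Measure (EuclideanSpace ℝ (Fin n))) : Prop :=
  IsProbabilityMeasure μ ∧
    ∀ L : EuclideanSpace ℝ (Fin n) →L[ℝ] ℝ, ∃ v : ℝ≥0, μ.map L = gaussianReal 0 v

section Determinants

open Matrix

variable {ι : Type*}

/-- Multiply by `τ` the entries of `C` joining the two blocks of indices cut out by `e`. -/
def crossScale (e : ι → Bool) (C : Matrix ι ι ℝ) (τ : ℝ) : Matrix ι ι ℝ :=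
  Matrix.of fun i j => if e i = e j then C i j else τ * C i j

lemma crossScale_one (e : ι → Bool) (C : Matrix ι ι ℝ) : crossScale e C 1 = C := by
  ext i j; simp [crossScale]

lemma crossScale_affine (e : ι → Bool) (C : Matrix ι ι ℝ) {a b : ℝ} (hab : a + b = 1)
    (s t : ℝ) :
    crossScale e C (a * s + b * t) = a • crossScale e C s + b • crossScale e C t := by
  ext i j
  simp only [crossScale, of_apply, Matrix.add_apply, Matrix.smul_apply, smul_eq_mul]
  split_ifs
  · rw [← add_mul, hab, one_mul]
  · ring

variable [DecidableEq ι]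

/-- The diagonal matrix with entries `±1` according to the block of each index. -/
def blockSign (e : ι → Bool) : Matrix ι ι ℝ :=
  diagonal fun i => if e i then 1 else -1

lemma blockSign_isHermitian (e : ι → Bool) : (blockSign e)ᴴ = blockSign e := by
  simp [blockSign]

variable [Fintype ι]

lemma crossScale_neg (e : ι → Bool) (C : Matrix ι ι ℝ) (τ : ℝ) :
    crossScale e C (-τ) = blockSign e * crossScale e C τ * blockSign e := by
  ext i j
  simp only [crossScale, blockSign, of_apply, diagonal_mul, mul_diagonal]
  cases e i <;> cases e j <;> simp

lemma crossScale_posSemidef_neg {e : ι → Bool} {C : Matrix ι ι ℝ} {τ : ℝ}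
    (h : (crossScale e C τ).PosSemidef) : (crossScale e C (-τ)).PosSemidef := by
  rw [crossScale_neg]
  simpa only [blockSign_isHermitian] using h.mul_mul_conjTranspose_same (blockSign e)

/-- For `0 ≤ s ≤ t`, the number `s` is a convex combination of `t` and `-t`. -/
lemma exists_convexComb_neg {s t : ℝ} (hs : 0 ≤ s) (hst : s ≤ t) :
    ∃ a b : ℝ, 0 ≤ a ∧ 0 ≤ b ∧ a + b = 1 ∧ s = a * t + b * -t := by
  rcases (hs.trans hst).eq_or_lt with h | h
  · exact ⟨1, 0, by simp, le_rfl, by simp, by linarith⟩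
  · refine ⟨(1 + s / t) / 2, (1 - s / t) / 2, by positivity, ?_, by ring, ?_⟩
    · have := (div_le_one h).2 hst
      linarith
    · field_simp; ring

lemma crossScale_posSemidef {e : ι → Bool} {C : Matrix ι ι ℝ} {s t : ℝ}
    (hC : (crossScale e C t).PosSemidef) (hs : 0 ≤ s) (hst : s ≤ t) :
    (crossScale e C s).PosSemidef := by
  obtain ⟨a, b, ha, hb, hab, rfl⟩ := exists_convexComb_neg hs hst
  rw [crossScale_affine e C hab]
  exact (hC.smul ha).add ((crossScale_posSemidef_neg hC).smul hb)

/-- The matrix whose rows are those of `A` for indices in `s` and those of `1` elsewhere. -/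
def rowsOrOne (s : Finset ι) (A : Matrix ι ι ℝ) : Matrix ι ι ℝ :=
  Matrix.of fun i j => if i ∈ s then A i j else (1 : Matrix ι ι ℝ) i j

/-- Expansion of `det (1 + Λ A)` along the subsets of the index set. -/
lemma det_one_add_diagonal_mul (l : ι → ℝ) (A : Matrix ι ι ℝ) :
    (1 + diagonal l * A).det =
      ∑ s : Finset ι, (∏ i ∈ s, l i) * (rowsOrOne s A).det := by
  have h1 : (1 + diagonal l * A : Matrix ι ι ℝ) = Matrix.of (fun i => l i • A i) + 1 := by
    rw [add_comm]; congr 1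
    ext i j; simp [diagonal_mul]
  rw [h1]
  have := (detRowAlternating (R := ℝ) (n := ι)).toMultilinearMap.map_add_univ
    (fun i => l i • A i) (1 : Matrix ι ι ℝ)
  refine this.trans (Finset.sum_congr rfl fun s _ => ?_)
  have h2 := (detRowAlternating (R := ℝ) (n := ι)).toMultilinearMap.map_piecewise_smul
    l (s.piecewise A (1 : Matrix ι ι ℝ)) s
  rw [smul_eq_mul] at h2
  have h3 : rowsOrOne s A = s.piecewise A (1 : Matrix ι ι ℝ) := by
    ext i j
    by_cases hi : i ∈ s <;> simp only [rowsOrOne, of_apply, Finset.piecewise, hi, if_true, if_false]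
  rw [h3]
  refine Eq.trans (congrArg _ ?_) h2
  ext i j
  by_cases hi : i ∈ s <;> simp only [Finset.piecewise, hi, if_true, if_false, Pi.smul_apply]

end Determinants

section Laplace

open Matrix

variable {ι : Type*} [Fintype ι] [DecidableEq ι]

lemma integral_exp_neg_sq_gaussianReal {m : ℝ} (hm : 0 ≤ m) :
    ∫ x, Real.exp (-(m * x ^ 2) / 2) ∂(gaussianReal 0 1) = (1 + m) ^ (-(1 / 2) : ℝ) := by
  rw [integral_gaussianReal_eq_integral_smul (by simp)]
  have h : ∀ x : ℝ, gaussianPDFReal 0 1 x • Real.exp (-(m * x ^ 2) / 2)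
      = (√(2 * Real.pi))⁻¹ * Real.exp (-((1 + m) / 2) * x ^ 2) := by
    intro x
    simp only [gaussianPDFReal, smul_eq_mul, NNReal.coe_one, mul_one, sub_zero]
    rw [mul_assoc, ← Real.exp_add]
    congr 2; ring
  simp_rw [h]
  rw [integral_const_mul, integral_gaussian, Real.rpow_neg (by positivity),
    ← Real.sqrt_eq_rpow, ← Real.sqrt_inv, ← Real.sqrt_inv, ← Real.sqrt_mul (by positivity)]
  congr 1
  have := Real.pi_pos
  field_simp

lemma det_one_add_eq_prod_eigenvalues {M : Matrix ι ι ℝ} (hM : M.IsHermitian) :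
    (1 + M).det = ∏ i, (1 + hM.eigenvalues i) := by
  have h := hM.spectral_theorem
  simp only [Unitary.conjStarAlgAut_apply] at h
  conv_lhs => rw [h]
  rw [mul_assoc, det_one_add_mul_comm, mul_assoc, Unitary.coe_star_mul_self, mul_one,
    ← diagonal_one, diagonal_add, det_diagonal]
  simp

lemma integral_exp_neg_quadratic_stdGaussian {M : Matrix ι ι ℝ} (hM : M.PosSemidef) :
    ∫ x, Real.exp (-(x.ofLp ⬝ᵥ M *ᵥ x.ofLp) / 2) ∂(stdGaussian (EuclideanSpace ℝ ι)) =
      (1 + M).det ^ (-(1 / 2) : ℝ) := by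
  have hpos := hM.eigenvalues_nonneg
  set b := hM.1.eigenvectorBasis with hb
  rw [stdGaussian_eq_map_pi_orthonormalBasis b, integral_map
    (Measurable.aemeasurable (by fun_prop)) (Measurable.aestronglyMeasurable (by fun_prop))]
  have key : ∀ x : ι → ℝ, (∑ i, x i • b i).ofLp ⬝ᵥ M *ᵥ (∑ i, x i • b i).ofLp
      = ∑ i, hM.1.eigenvalues i * x i ^ 2 := by
    intro x
    have h1 : M *ᵥ (∑ i, x i • b i).ofLp
        = (∑ i, (x i * hM.1.eigenvalues i) • b i : EuclideanSpace ℝ ι).ofLp := by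
      simp only [WithLp.ofLp_sum, WithLp.ofLp_smul, Matrix.mulVec_sum, Matrix.mulVec_smul]
      refine Finset.sum_congr rfl fun i _ => ?_
      rw [hb, hM.1.mulVec_eigenvectorBasis, smul_smul]
    have h2 := EuclideanSpace.inner_eq_star_dotProduct
      (∑ i, (x i * hM.1.eigenvalues i) • b i) (∑ i, x i • b i)
    rw [star_trivial] at h2
    rw [h1, ← h2, b.orthonormal.inner_sum]
    refine Finset.sum_congr rfl fun i _ => ?_
    simp; ring
  simp_rw [key, ← Finset.sum_neg_distrib, Finset.sum_div, Real.exp_sum]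
  rw [integral_fintype_prod_eq_prod
    (f := fun i (x : ℝ) => Real.exp (-(hM.1.eigenvalues i * x ^ 2) / 2)),
    det_one_add_eq_prod_eigenvalues hM.1,
    ← Real.finsetProd_rpow _ _ fun i _ => add_nonneg zero_le_one (hpos i)]
  exact Finset.prod_congr rfl fun i _ => integral_exp_neg_sq_gaussianReal (hpos i)

/-- Laplace transform of the squared coordinates of a centered Gaussian vector. -/
lemma integral_exp_neg_sum_sq_multivariateGaussian {C : Matrix ι ι ℝ} (hC : C.PosSemidef)
    {l : ι → ℝ} (hl : ∀ i, 0 ≤ l i) :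
    ∫ x, Real.exp (-(∑ i, l i * x i ^ 2) / 2) ∂(multivariateGaussian 0 C) =
      (1 + diagonal l * C).det ^ (-(1 / 2) : ℝ) := by
  open scoped MatrixOrder in
  have hsq : (CFC.sqrt C).IsHermitian := (CFC.sqrt_nonneg C).isSelfAdjoint
  open scoped MatrixOrder in
  have hsC : CFC.sqrt C * CFC.sqrt C = C := CFC.sqrt_mul_sqrt_self C hC.nonneg
  have hM : (CFC.sqrt C * diagonal l * CFC.sqrt C).PosSemidef := by
    have := (PosSemidef.diagonal hl).mul_mul_conjTranspose_same (CFC.sqrt C)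
    rwa [hsq.eq] at this
  rw [multivariateGaussian, integral_map (by fun_prop)
    (Measurable.aestronglyMeasurable (by fun_prop))]
  have hdet : (1 + diagonal l * C).det = (1 + CFC.sqrt C * diagonal l * CFC.sqrt C).det := by
    rw [mul_assoc, det_one_add_mul_comm (CFC.sqrt C), mul_assoc, hsC]
  rw [hdet, ← integral_exp_neg_quadratic_stdGaussian hM]
  congr 1; ext x; congr 3
  have h : ∀ y : ι → ℝ, ∑ i, l i * y i ^ 2 = y ⬝ᵥ diagonal l *ᵥ y := by
    intro y
    simp only [dotProduct, mulVec_diagonal]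
    exact Finset.sum_congr rfl fun i _ => by ring
  have hT : (CFC.sqrt C)ᵀ = CFC.sqrt C := by
    rw [← conjTranspose_eq_transpose_of_trivial, hsq.eq]
  rw [zero_add, h, ofLp_toEuclideanCLM, mul_assoc, ← mulVec_mulVec, ← mulVec_mulVec,
    dotProduct_mulVec x.ofLp, ← mulVec_transpose, hT]

omit [DecidableEq ι] in
lemma integrable_exp_neg_quadratic {M : Matrix ι ι ℝ} (hM : M.PosSemidef)
    (μ : Measure (EuclideanSpace ℝ ι)) [IsFiniteMeasure μ] :
    Integrable (fun x => Real.exp (-(x.ofLp ⬝ᵥ M *ᵥ x.ofLp) / 2)) μ := by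
  refine Integrable.of_bound (C := 1) (Measurable.aestronglyMeasurable ?_)
    (Filter.Eventually.of_forall fun x => ?_)
  · simp only [dotProduct, mulVec]
    fun_prop
  · rw [Real.norm_of_nonneg (Real.exp_nonneg _), Real.exp_le_one_iff]
    have := hM.dotProduct_mulVec_nonneg x.ofLp
    rw [star_trivial] at this
    linarith

lemma one_add_det_pos {M : Matrix ι ι ℝ} (hM : M.PosSemidef) : 0 < (1 + M).det :=
  (PosDef.one.add_posSemidef hM).det_pos

/-- The determinant does not decrease under convex combinations of positive semidefinite
matrices that share it. -/
lemma det_one_add_le_of_convexComb {M N : Matrix ι ι ℝ} (hM : M.PosSemidef)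
    (hN : N.PosSemidef) (hMN : (1 + M).det = (1 + N).det) {a b : ℝ} (ha : 0 ≤ a) (hb : 0 ≤ b)
    (hab : a + b = 1) : (1 + M).det ≤ (1 + (a • M + b • N)).det := by
  have hP := (hM.smul ha).add (hN.smul hb)
  rw [← Real.rpow_le_rpow_iff_of_neg (one_add_det_pos hP) (one_add_det_pos hM)
    (by norm_num : (-(1 / 2) : ℝ) < 0), ← integral_exp_neg_quadratic_stdGaussian hP]
  have hM' := integrable_exp_neg_quadratic hM (stdGaussian (EuclideanSpace ℝ ι))
  have hN' := integrable_exp_neg_quadratic hN (stdGaussian (EuclideanSpace ℝ ι))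
  calc _ ≤ ∫ x, (a * Real.exp (-(x.ofLp ⬝ᵥ M *ᵥ x.ofLp) / 2)
        + b * Real.exp (-(x.ofLp ⬝ᵥ N *ᵥ x.ofLp) / 2)) ∂(stdGaussian (EuclideanSpace ℝ ι)) := by
        refine integral_mono (integrable_exp_neg_quadratic hP _)
          ((hM'.const_mul a).add (hN'.const_mul b)) fun x => ?_
        have := convexOn_exp.2 (Set.mem_univ (-(x.ofLp ⬝ᵥ M *ᵥ x.ofLp) / 2))
          (Set.mem_univ (-(x.ofLp ⬝ᵥ N *ᵥ x.ofLp) / 2)) ha hb hab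
        simp only [smul_eq_mul] at this
        refine le_trans (le_of_eq ?_) this
        congr 1
        simp only [add_mulVec, smul_mulVec, dotProduct_add, dotProduct_smul, smul_eq_mul]
        ring
    _ = _ := by
        rw [integral_add (hM'.const_mul a) (hN'.const_mul b), integral_const_mul,
          integral_const_mul, integral_exp_neg_quadratic_stdGaussian hM,
          integral_exp_neg_quadratic_stdGaussian hN, ← hMN, ← add_mul, hab, one_mul]

lemma det_one_add_diagonal_mul_eq {l : ι → ℝ} (hl : ∀ i, 0 ≤ l i) (A : Matrix ι ι ℝ) :
    (1 + diagonal l * A).det =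
      (1 + diagonal (fun i => √(l i)) * A * diagonal (fun i => √(l i))).det := by
  rw [mul_assoc, det_one_add_mul_comm (diagonal fun i => √(l i)), mul_assoc, diagonal_mul_diagonal,
    det_one_add_mul_comm]
  simp only [Real.mul_self_sqrt (hl _)]

lemma posSemidef_sqrt_diagonal_conj (l : ι → ℝ) {A : Matrix ι ι ℝ} (hA : A.PosSemidef) :
    (diagonal (fun i => √(l i)) * A * diagonal (fun i => √(l i))).PosSemidef := by
  have := hA.mul_mul_conjTranspose_same (diagonal (fun i => √(l i)))
  simpa [diagonal_conjTranspose] using this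

lemma det_one_add_diagonal_mul_pos {C : Matrix ι ι ℝ} (hC : C.PosSemidef)
    {l : ι → ℝ} (hl : ∀ i, 0 ≤ l i) : 0 < (1 + diagonal l * C).det := by
  rw [det_one_add_diagonal_mul_eq hl]
  exact one_add_det_pos (posSemidef_sqrt_diagonal_conj l hC)

lemma det_one_add_diagonal_mul_crossScale_neg (e : ι → Bool) (C : Matrix ι ι ℝ)
    (l : ι → ℝ) (t : ℝ) :
    (1 + diagonal l * crossScale e C (-t)).det = (1 + diagonal l * crossScale e C t).det := by
  have h : blockSign e * diagonal l * blockSign e = diagonal l := by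
    rw [blockSign, diagonal_mul_diagonal, diagonal_mul_diagonal]
    congr 1; ext i; split_ifs <;> simp
  rw [crossScale_neg, ← mul_assoc, det_one_add_mul_comm, ← mul_assoc, ← mul_assoc, h]

lemma det_one_add_diagonal_mul_crossScale_anti {e : ι → Bool} {C : Matrix ι ι ℝ}
    {l : ι → ℝ} (hl : ∀ i, 0 ≤ l i) {s t : ℝ}
    (hC : (crossScale e C t).PosSemidef) (hs : 0 ≤ s) (hst : s ≤ t) :
    (1 + diagonal l * crossScale e C t).det ≤ (1 + diagonal l * crossScale e C s).det := by
  obtain ⟨a, b, ha, hb, hab, rfl⟩ := exists_convexComb_neg hs hst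
  have hneg := det_one_add_diagonal_mul_crossScale_neg e C l t
  rw [det_one_add_diagonal_mul_eq hl, det_one_add_diagonal_mul_eq hl] at hneg
  have := det_one_add_le_of_convexComb (posSemidef_sqrt_diagonal_conj l hC)
    (posSemidef_sqrt_diagonal_conj l (crossScale_posSemidef_neg hC)) hneg.symm ha hb hab
  rw [det_one_add_diagonal_mul_eq hl, det_one_add_diagonal_mul_eq hl,
    crossScale_affine e C hab]
  simpa only [mul_add, add_mul, mul_smul_comm, smul_mul_assoc] using this

end Laplace

section Monotonicity

open Matrix Polynomial Filter Topology

variable {ι : Type*} [Fintype ι] [DecidableEq ι]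

/-- The principal minor of `crossScale e C τ` with rows in `s`. -/
def crossMinor (e : ι → Bool) (C : Matrix ι ι ℝ) (s : Finset ι) (τ : ℝ) : ℝ :=
  (rowsOrOne s (crossScale e C τ)).det

lemma differentiable_crossMinor (e : ι → Bool) (C : Matrix ι ι ℝ) (s : Finset ι) :
    Differentiable ℝ (crossMinor e C s) := by
  unfold crossMinor
  simp only [det_apply]
  refine Differentiable.fun_sum fun σ _ => Differentiable.const_smul ?_ _
  refine Differentiable.fun_finsetProd fun i _ => ?_
  by_cases hi : σ i ∈ s
  · simp only [rowsOrOne, of_apply, hi, if_true, crossScale]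
    split_ifs <;> fun_prop
  · simp only [rowsOrOne, of_apply, hi, if_false]
    fun_prop

lemma det_piecewise_smul_add (A : Matrix ι ι ℝ) (s : Finset ι) {u : ℝ} (hu : u ≠ 0) :
    (rowsOrOne s (u • (1 : Matrix ι ι ℝ) + A)).det =
      u ^ s.card * (1 + diagonal (fun i => if i ∈ s then u⁻¹ else 0) * A).det := by
  have h : rowsOrOne s (u • (1 : Matrix ι ι ℝ) + A) =
      diagonal (fun i => if i ∈ s then u else 1) *
        (1 + diagonal (fun i => if i ∈ s then u⁻¹ else 0) * A) := by
    ext i j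
    by_cases hi : i ∈ s <;>
      simp [rowsOrOne, of_apply, hi, diagonal_mul, mul_add, mul_inv_cancel_left₀ hu]
  rw [h, det_mul, det_diagonal, Finset.prod_ite_mem, Finset.univ_inter, Finset.prod_const]

lemma crossMinor_antitoneOn (e : ι → Bool) {C : Matrix ι ι ℝ} (hC : C.PosSemidef)
    (s : Finset ι) : AntitoneOn (crossMinor e C s) (Set.Icc 0 1) := by
  intro t₁ ht₁ t₂ ht₂ h
  have hlim : ∀ t, Tendsto (fun u : ℝ =>
      (rowsOrOne s (u • (1 : Matrix ι ι ℝ) + crossScale e C t)).det)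
      (𝓝[>] 0) (𝓝 (crossMinor e C s t)) := by
    intro t
    have hc : Continuous (fun u : ℝ =>
      (rowsOrOne s (u • (1 : Matrix ι ι ℝ) + crossScale e C t)).det) := by
      refine Continuous.matrix_det (continuous_pi fun i => continuous_pi fun j => ?_)
      by_cases hi : i ∈ s
      · simp only [rowsOrOne, of_apply, hi, if_true, Matrix.add_apply, Matrix.smul_apply]
        fun_prop
      · simp only [rowsOrOne, of_apply, hi, if_false]
        fun_prop
    have := (hc.tendsto 0).mono_left (nhdsWithin_le_nhds (s := Set.Ioi 0))
    simpa [crossMinor] using this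
  refine le_of_tendsto_of_tendsto (hlim t₂) (hlim t₁) ?_
  filter_upwards [self_mem_nhdsWithin] with u hu
  have hu : 0 < u := hu
  rw [det_piecewise_smul_add _ _ hu.ne', det_piecewise_smul_add _ _ hu.ne']
  refine mul_le_mul_of_nonneg_left ?_ (by positivity)
  refine det_one_add_diagonal_mul_crossScale_anti (fun i => ?_) ?_ ht₁.1 h
  · split_ifs <;> positivity
  · refine crossScale_posSemidef (t := 1) ?_ ht₂.1 ht₂.2
    rwa [crossScale_one]

lemma deriv_crossMinor_nonpos (e : ι → Bool) {C : Matrix ι ι ℝ} (hC : C.PosSemidef)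
    (s : Finset ι) {t : ℝ} (ht : t ∈ Set.Ioo 0 1) : deriv (crossMinor e C s) t ≤ 0 := by
  have h := (crossMinor_antitoneOn e hC s).derivWithin_nonpos (x := t)
  rwa [derivWithin_of_mem_nhds (Icc_mem_nhds ht.1 ht.2)] at h

lemma hasDerivAt_det_crossScale (e : ι → Bool) (C : Matrix ι ι ℝ) (l : ι → ℝ) (t : ℝ) :
    HasDerivAt (fun τ => (1 + diagonal l * crossScale e C τ).det)
      (∑ s : Finset ι, (∏ i ∈ s, l i) * deriv (crossMinor e C s) t) t := by
  simp_rw [det_one_add_diagonal_mul]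
  exact HasDerivAt.fun_sum fun s _ =>
    ((differentiable_crossMinor e C s) t).hasDerivAt.const_mul _

/-- Expansion of a product of polynomials and of their images under `y d/dy`. -/
lemma sum_piFinset_support_eq_prod (p : ι → ℝ[X]) (s : Finset ι) (y : ι → ℝ) :
    ∑ m ∈ Fintype.piFinset (fun i => (p i).support),
      (∏ i, (p i).coeff (m i)) * (∏ i ∈ s, (m i : ℝ)) * ∏ i, y i ^ m i =
    ∏ i, if i ∈ s then y i * (derivative (p i)).eval (y i) else (p i).eval (y i) := by
  have h : ∀ i, (if i ∈ s then y i * (derivative (p i)).eval (y i) else (p i).eval (y i)) =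
      ∑ n ∈ (p i).support, (p i).coeff n * (if i ∈ s then (n : ℝ) else 1) * y i ^ n := by
    intro i
    split_ifs with hi
    · rw [derivative_eval, Polynomial.sum, Finset.mul_sum]
      refine Finset.sum_congr rfl fun n _ => ?_
      rcases n with _ | n
      · simp
      · simp only [Nat.add_sub_cancel, pow_succ]; ring
    · rw [eval_eq_sum, Polynomial.sum]; simp
  simp_rw [h]
  rw [Finset.prod_univ_sum]
  refine Finset.sum_congr rfl fun m _ => ?_
  rw [Finset.prod_mul_distrib, Finset.prod_mul_distrib, Finset.prod_ite_mem, Finset.univ_inter]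

omit [DecidableEq ι] in
lemma gaussianWeight_prod_pow (m : ι → ℕ) (x : ι → ℝ) :
    ∏ i, Real.exp (-(x i ^ 2) / 2) ^ m i = Real.exp (-(∑ i, (m i : ℝ) * x i ^ 2) / 2) := by
  simp_rw [← Real.exp_nat_mul, ← Real.exp_sum]
  rw [← Finset.sum_neg_distrib, Finset.sum_div]
  congr 1
  exact Finset.sum_congr rfl fun i _ => by ring

lemma integral_prod_pow_multivariateGaussian {C : Matrix ι ι ℝ} (hC : C.PosSemidef)
    (m : ι → ℕ) :
    ∫ x, ∏ i, Real.exp (-(x i ^ 2) / 2) ^ m i ∂(multivariateGaussian 0 C) =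
      (1 + diagonal (fun i => (m i : ℝ)) * C).det ^ (-(1 / 2) : ℝ) := by
  rw [← integral_exp_neg_sum_sq_multivariateGaussian hC fun i => Nat.cast_nonneg (m i)]
  exact integral_congr_ae (Eventually.of_forall fun x => gaussianWeight_prod_pow m x)

lemma exp_neg_sq_mem_Icc (x : ℝ) : Real.exp (-(x ^ 2) / 2) ∈ Set.Icc (0 : ℝ) 1 :=
  ⟨Real.exp_nonneg _, Real.exp_le_one_iff.2 (by nlinarith [sq_nonneg x])⟩

omit [DecidableEq ι] in
lemma integrable_prod_pow {Ω : Type*} [MeasurableSpace Ω] {P : Measure Ω} [IsFiniteMeasure P]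
    {Y : ι → Ω → ℝ} (hY : ∀ i, Measurable (Y i)) (hY01 : ∀ i w, Y i w ∈ Set.Icc (0 : ℝ) 1)
    (m : ι → ℕ) : Integrable (fun w => ∏ i, Y i w ^ m i) P := by
  refine Integrable.of_bound (C := 1) (Measurable.aestronglyMeasurable (by fun_prop))
    (Eventually.of_forall fun w => ?_)
  rw [Real.norm_of_nonneg (Finset.prod_nonneg fun i _ => pow_nonneg (hY01 i w).1 _)]
  exact Finset.prod_le_one (fun i _ => pow_nonneg (hY01 i w).1 _)
    fun i _ => pow_le_one₀ (hY01 i w).1 (hY01 i w).2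

lemma sum_coeff_mul_det_rpow_nonneg {C : Matrix ι ι ℝ} (hC : C.PosSemidef) {p : ι → ℝ[X]}
    (hp : ∀ i, ∀ y ∈ Set.Icc (0 : ℝ) 1, 0 ≤ (p i).eval y)
    (hp' : ∀ i, ∀ y ∈ Set.Icc (0 : ℝ) 1, 0 ≤ (derivative (p i)).eval y) (s : Finset ι) :
    0 ≤ ∑ m ∈ Fintype.piFinset (fun i => (p i).support),
      (∏ i, (p i).coeff (m i)) * (∏ i ∈ s, (m i : ℝ)) *
        (1 + diagonal (fun i => (m i : ℝ)) * C).det ^ (-(1 / 2) - 1 : ℝ) := by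
  set ρ := multivariateGaussian 0 C
  let y : ι → EuclideanSpace ℝ ι → ℝ := fun i x => Real.exp (-(x i ^ 2) / 2)
  let Y : ι → EuclideanSpace ℝ ι × EuclideanSpace ℝ ι × EuclideanSpace ℝ ι → ℝ :=
    fun i w => y i w.1 * (y i w.2.1 * y i w.2.2)
  have hYm : ∀ i, Measurable (Y i) := fun i => by
    simp only [Y, y]; fun_prop
  have hY01 : ∀ i w, Y i w ∈ Set.Icc (0 : ℝ) 1 := fun i w => by
    have h : ∀ x, y i x ∈ Set.Icc (0 : ℝ) 1 := fun x => exp_neg_sq_mem_Icc _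
    have h2 := unitInterval.mul_mem (h w.2.1) (h w.2.2)
    exact unitInterval.mul_mem (h w.1) h2
  have hint : ∀ m : ι → ℕ, (1 + diagonal (fun i => (m i : ℝ)) * C).det ^ (-(1 / 2) - 1 : ℝ) =
      ∫ w, ∏ i, Y i w ^ m i ∂(ρ.prod (ρ.prod ρ)) := by
    intro m
    have h1 : ∀ w, ∏ i, Y i w ^ m i =
        (∏ i, y i w.1 ^ m i) * ((∏ i, y i w.2.1 ^ m i) * ∏ i, y i w.2.2 ^ m i) := fun w => by
      simp only [Y, mul_pow, Finset.prod_mul_distrib]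
    simp_rw [h1]
    rw [integral_prod_mul (fun x => ∏ i, y i x ^ m i)
      (fun w : EuclideanSpace ℝ ι × EuclideanSpace ℝ ι =>
        (∏ i, y i w.1 ^ m i) * ∏ i, y i w.2 ^ m i),
      integral_prod_mul (fun x => ∏ i, y i x ^ m i) (fun x => ∏ i, y i x ^ m i),
      integral_prod_pow_multivariateGaussian hC]
    have hpos := det_one_add_diagonal_mul_pos hC (l := fun i => (m i : ℝ))
      fun i => Nat.cast_nonneg _
    rw [← Real.rpow_add hpos, ← Real.rpow_add hpos]
    norm_num
  simp_rw [hint, ← integral_const_mul]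
  rw [← integral_finsetSum _ fun m _ => (integrable_prod_pow hYm hY01 m).const_mul _]
  refine integral_nonneg fun w => ?_
  simp only [Pi.zero_apply]
  rw [sum_piFinset_support_eq_prod p s fun i => Y i w]
  refine Finset.prod_nonneg fun i _ => ?_
  split_ifs
  · exact mul_nonneg (hY01 i w).1 (hp' i _ (hY01 i w))
  · exact hp i _ (hY01 i w)

/-- Royen's monotonicity: increasing the correlation between two blocks of a centered Gaussian
vector increases the expectation of products of decreasing functions of the squared coordinates. -/
lemma integral_prod_eval_multivariateGaussian_monotoneOn (e : ι → Bool) {C : Matrix ι ι ℝ}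
    (hC : C.PosSemidef) {p : ι → ℝ[X]}
    (hp : ∀ i, ∀ y ∈ Set.Icc (0 : ℝ) 1, 0 ≤ (p i).eval y)
    (hp' : ∀ i, ∀ y ∈ Set.Icc (0 : ℝ) 1, 0 ≤ (derivative (p i)).eval y) :
    MonotoneOn (fun τ => ∫ x, ∏ i, (p i).eval (Real.exp (-(x i ^ 2) / 2))
      ∂(multivariateGaussian 0 (crossScale e C τ))) (Set.Icc 0 1) := by
  have hCt : ∀ t ∈ Set.Icc (0 : ℝ) 1, (crossScale e C t).PosSemidef := fun t ht =>
    crossScale_posSemidef (t := 1) (by rwa [crossScale_one]) ht.1 ht.2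
  let D : (ι → ℕ) → ℝ → ℝ := fun m t =>
    (1 + diagonal (fun i => (m i : ℝ)) * crossScale e C t).det
  let F : ℝ → ℝ := fun t => ∑ m ∈ Fintype.piFinset (fun i => (p i).support),
      (∏ i, (p i).coeff (m i)) * D m t ^ (-(1 / 2) : ℝ)
  have hF : Set.EqOn F (fun τ => ∫ x, ∏ i, (p i).eval (Real.exp (-(x i ^ 2) / 2))
      ∂(multivariateGaussian 0 (crossScale e C τ))) (Set.Icc 0 1) := by
    intro t ht
    simp only [F, D]
    simp_rw [← integral_prod_pow_multivariateGaussian (hCt t ht), ← integral_const_mul]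
    rw [← integral_finsetSum]
    · refine integral_congr_ae (Eventually.of_forall fun x => ?_)
      have := sum_piFinset_support_eq_prod p ∅ fun i => Real.exp (-(x i ^ 2) / 2)
      simpa using this
    · exact fun m _ => (integrable_prod_pow
        (Y := fun i (x : EuclideanSpace ℝ ι) => Real.exp (-(x i ^ 2) / 2))
        (fun i => by fun_prop) (fun i x => exp_neg_sq_mem_Icc _) m).const_mul _
  have hDpos : ∀ m, ∀ t ∈ Set.Icc (0 : ℝ) 1, 0 < D m t := fun m t ht =>
    det_one_add_diagonal_mul_pos (hCt t ht) fun i => Nat.cast_nonneg _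
  have hderiv : ∀ t ∈ Set.Icc (0 : ℝ) 1, HasDerivAt F
      (∑ m ∈ Fintype.piFinset (fun i => (p i).support), (∏ i, (p i).coeff (m i)) *
        ((∑ s : Finset ι, (∏ i ∈ s, (m i : ℝ)) * deriv (crossMinor e C s) t) *
          (-(1 / 2)) * D m t ^ (-(1 / 2) - 1 : ℝ))) t := fun t ht =>
    HasDerivAt.fun_sum fun m _ => ((hasDerivAt_det_crossScale e C _ t).rpow_const
      (Or.inl (hDpos m t ht).ne')).const_mul _
  refine MonotoneOn.congr ?_ hF
  refine monotoneOn_of_deriv_nonneg (convex_Icc 0 1)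
    (fun t ht => (hderiv t ht).continuousAt.continuousWithinAt)
    (fun t ht => (hderiv t (interior_subset ht)).differentiableAt.differentiableWithinAt)
    fun t ht => ?_
  rw [(hderiv t (interior_subset ht)).deriv]
  have hswap : (∑ m ∈ Fintype.piFinset (fun i => (p i).support), (∏ i, (p i).coeff (m i)) *
        ((∑ s : Finset ι, (∏ i ∈ s, (m i : ℝ)) * deriv (crossMinor e C s) t) *
          (-(1 / 2)) * D m t ^ (-(1 / 2) - 1 : ℝ))) =
      ∑ s : Finset ι, (-(1 / 2) * deriv (crossMinor e C s) t) *
        ∑ m ∈ Fintype.piFinset (fun i => (p i).support),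
          (∏ i, (p i).coeff (m i)) * (∏ i ∈ s, (m i : ℝ)) * D m t ^ (-(1 / 2) - 1 : ℝ) := by
    simp_rw [Finset.mul_sum, Finset.sum_mul, Finset.mul_sum]
    rw [Finset.sum_comm]
    exact Finset.sum_congr rfl fun s _ => Finset.sum_congr rfl fun m _ => by ring
  rw [hswap]
  rw [interior_Icc] at ht
  refine Finset.sum_nonneg fun s _ => mul_nonneg ?_
    (sum_coeff_mul_det_rpow_nonneg (hCt t (Set.Ioo_subset_Icc_self ht)) hp hp' s)
  have := deriv_crossMinor_nonpos e hC s ht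
  linarith

end Monotonicity

section Strips

open Matrix Polynomial Filter Topology
open scoped RealInnerProductSpace

/-- Increasing polynomials on `[0, 1]` that converge to the indicator function of `[c, 1]`. -/
lemma exists_polynomial_tendsto_indicator {c : ℝ} (hc0 : 0 < c) (hc1 : c < 1) :
    ∃ p : ℕ → ℝ[X], (∀ k, ∀ y ∈ Set.Icc (0 : ℝ) 1, (p k).eval y ∈ Set.Icc (0 : ℝ) 1) ∧
      (∀ k, ∀ y ∈ Set.Icc (0 : ℝ) 1, 0 ≤ (derivative (p k)).eval y) ∧
      ∀ y ∈ Set.Icc (0 : ℝ) 1,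
        Tendsto (fun k => (p k).eval y) atTop (𝓝 (if c ≤ y then 1 else 0)) := by
  let M : ℕ → ℕ := fun k => ⌈k * (c ^ k)⁻¹⌉₊
  have hpow : ∀ k : ℕ, ∀ y ∈ Set.Icc (0 : ℝ) 1, 0 ≤ 1 - y ^ k ∧ 1 - y ^ k ≤ 1 := fun k y hy =>
    ⟨sub_nonneg.2 (pow_le_one₀ hy.1 hy.2), by linarith [pow_nonneg hy.1 k]⟩
  refine ⟨fun k => 1 - (1 - X ^ k) ^ M k, fun k y hy => ?_, fun k y hy => ?_, fun y hy => ?_⟩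
  · obtain ⟨h1, h2⟩ := hpow k y hy
    simp only [eval_sub, eval_one, eval_pow, eval_X]
    exact ⟨sub_nonneg.2 (pow_le_one₀ h1 h2), by linarith [pow_nonneg h1 (M k)]⟩
  · obtain ⟨h1, h2⟩ := hpow k y hy
    simp only [derivative_sub, derivative_one, derivative_pow, derivative_X, eval_sub,
      eval_mul, eval_pow, eval_X, eval_one, mul_one, zero_sub, eval_C, mul_neg, neg_neg]
    have := hy.1
    positivity
  · simp only [eval_sub, eval_one, eval_pow, eval_X]
    split_ifs with h
    · have hbound : ∀ k : ℕ, (1 - y ^ k) ^ M k ≤ Real.exp (-k) := by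
        intro k
        obtain ⟨h1, h2⟩ := hpow k y hy
        have hck : 0 < c ^ k := pow_pos hc0 k
        calc (1 - y ^ k) ^ M k ≤ Real.exp (-c ^ k) ^ M k := by
              refine pow_le_pow_left₀ h1 ?_ _
              have := Real.add_one_le_exp (-c ^ k)
              have := pow_le_pow_left₀ hc0.le h k
              linarith
          _ ≤ Real.exp (-k) := by
              rw [← Real.exp_nat_mul, Real.exp_le_exp]
              have := Nat.le_ceil (k * (c ^ k)⁻¹)
              have : (k : ℝ) ≤ M k * c ^ k := by
                rwa [← div_le_iff₀ hck, div_eq_mul_inv]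
              linarith
      have : Tendsto (fun k : ℕ => (1 - y ^ k) ^ M k) atTop (𝓝 0) :=
        squeeze_zero (fun k => pow_nonneg (hpow k y hy).1 _) hbound
          (Real.tendsto_exp_neg_atTop_nhds_zero.comp tendsto_natCast_atTop_atTop)
      simpa using this.const_sub 1
    · have hyc : y / c < 1 := (div_lt_one hc0).2 (not_le.1 h)
      have hbound : ∀ k : ℕ, 1 - (1 - y ^ k) ^ M k ≤ k * (y / c) ^ k + y ^ k := by
        intro k
        obtain ⟨h1, h2⟩ := hpow k y hy
        have hb := one_add_mul_le_pow (a := -y ^ k) (by linarith) (M k)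
        rw [← sub_eq_add_neg] at hb
        have hM : (M k : ℝ) ≤ k * (c ^ k)⁻¹ + 1 := (Nat.ceil_lt_add_one (by positivity)).le
        have := mul_le_mul_of_nonneg_right hM (pow_nonneg hy.1 k)
        rw [div_pow, div_eq_mul_inv]
        linarith
      refine squeeze_zero (fun k => sub_nonneg.2 (pow_le_one₀ (hpow k y hy).1 (hpow k y hy).2))
        hbound ?_
      have h1 := tendsto_self_mul_const_pow_of_lt_one (div_nonneg hy.1 hc0.le) hyc
      have h2 := tendsto_pow_atTop_nhds_zero_of_lt_one hy.1 ((not_le.1 h).trans hc1)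
      simpa using h1.add h2

variable {ι : Type*} [Fintype ι] [DecidableEq ι]

/-- The Gaussian correlation inequality for cubes. -/
lemma multivariateGaussian_cube_le (e : ι → Bool) {C : Matrix ι ι ℝ} (hC : C.PosSemidef) :
    multivariateGaussian 0 (crossScale e C 0) {x | ∀ i, |x i| ≤ 1} ≤
      multivariateGaussian 0 C {x | ∀ i, |x i| ≤ 1} := by
  obtain ⟨p, hp01, hp', hlim⟩ := exists_polynomial_tendsto_indicator
    (Real.exp_pos (-(1 / 2))) (Real.exp_lt_one_iff.2 (by norm_num))
  have hmeas : MeasurableSet {x : EuclideanSpace ℝ ι | ∀ i, |x i| ≤ 1} := by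
    rw [Set.ofPred_forall]
    exact MeasurableSet.iInter fun i => measurableSet_le (by fun_prop) measurable_const
  have hreal : ∀ S : Matrix ι ι ℝ, Tendsto (fun k : ℕ =>
      ∫ x, ∏ i, (p k).eval (Real.exp (-(x i ^ 2) / 2)) ∂(multivariateGaussian 0 S)) atTop
      (𝓝 ((multivariateGaussian 0 S).real {x : EuclideanSpace ℝ ι | ∀ i, |x i| ≤ 1})) := by
    intro S
    rw [← integral_indicator_one hmeas]
    refine tendsto_integral_of_dominated_convergence (fun _ => 1)
      (fun k => ?_) (integrable_const _) (fun k => Eventually.of_forall fun x => ?_)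
      (Eventually.of_forall fun x => ?_)
    · refine Measurable.aestronglyMeasurable (Finset.measurable_prod _ fun i _ => ?_)
      exact (p k).continuous.measurable.comp (by fun_prop)
    · have h := fun i => hp01 k _ (exp_neg_sq_mem_Icc (x i))
      rw [Real.norm_of_nonneg (Finset.prod_nonneg fun i _ => (h i).1)]
      exact Finset.prod_le_one (fun i _ => (h i).1) fun i _ => (h i).2
    · have h := tendsto_finsetProd Finset.univ fun i _ => hlim _ (exp_neg_sq_mem_Icc (x i))
      convert h using 2
      have hiff : ∀ i, Real.exp (-(1 / 2)) ≤ Real.exp (-(x i ^ 2) / 2) ↔ |x i| ≤ 1 := by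
        intro i
        rw [Real.exp_le_exp, ← sq_le_one_iff_abs_le_one]
        constructor <;> intro h <;> linarith
      simp only [hiff, Set.indicator_apply, Set.mem_ofPred_eq, Pi.one_apply]
      rw [Finset.prod_ite_zero]
      simp
  have hle : ∀ k, _ := fun k => integral_prod_eval_multivariateGaussian_monotoneOn e hC
    (p := fun _ => p k) (fun i y hy => (hp01 k y hy).1) (fun i y hy => hp' k y hy)
    (Set.left_mem_Icc.2 zero_le_one) (Set.right_mem_Icc.2 zero_le_one) zero_le_one
  simp only [crossScale_one] at hle
  have := le_of_tendsto_of_tendsto' (hreal (crossScale e C 0)) (hreal C) hle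
  exact (ENNReal.toReal_le_toReal (measure_ne_top _ _) (measure_ne_top _ _)).1 this

variable {E : Type*} [NormedAddCommGroup E] [InnerProductSpace ℝ E]

omit [DecidableEq ι] in
lemma gram_quadratic (v : ι → E) (t : ι → ℝ) :
    t ⬝ᵥ (Matrix.of fun i j => ⟪v i, v j⟫) *ᵥ t = ‖∑ i, t i • v i‖ ^ 2 := by
  rw [← real_inner_self_eq_norm_sq, sum_inner]
  simp only [inner_sum, real_inner_smul_left, real_inner_smul_right, dotProduct, mulVec, of_apply]
  refine Finset.sum_congr rfl fun i _ => ?_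
  rw [Finset.mul_sum]
  exact Finset.sum_congr rfl fun j _ => by ring

omit [DecidableEq ι] in
lemma posSemidef_gram (v : ι → E) : (Matrix.of fun i j => ⟪v i, v j⟫ : Matrix ι ι ℝ).PosSemidef := by
  refine PosSemidef.of_dotProduct_mulVec_nonneg ?_ fun t => ?_
  · ext i j; simp [real_inner_comm]
  · rw [star_trivial, gram_quadratic]; positivity

variable [FiniteDimensional ℝ E] [MeasurableSpace E] [BorelSpace E]

lemma map_inner_stdGaussian (v : ι → E) :
    (stdGaussian E).map (fun x => WithLp.toLp 2 fun i => ⟪v i, x⟫) =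
      multivariateGaussian 0 (Matrix.of fun i j => ⟪v i, v j⟫) := by
  have : IsProbabilityMeasure ((stdGaussian E).map (fun x => WithLp.toLp 2 fun i => ⟪v i, x⟫)) :=
    Measure.isProbabilityMeasure_map (Measurable.aemeasurable (by fun_prop))
  refine Measure.ext_of_charFun (funext fun t => ?_)
  rw [charFun_multivariateGaussian (posSemidef_gram v), gram_quadratic, charFun_apply,
    integral_map (Measurable.aemeasurable (by fun_prop))
      (Measurable.aestronglyMeasurable (by fun_prop))]
  have h : ∀ x : E, ⟪WithLp.toLp 2 fun i => ⟪v i, x⟫, t⟫ = ⟪x, ∑ i, t i • v i⟫ := by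
    intro x
    simp [PiLp.inner_apply, inner_sum, real_inner_smul_right, real_inner_comm]
  simp_rw [h]
  rw [← charFun_apply, charFun_stdGaussian]
  simp [neg_div]

lemma map_inner_stdGaussian_prod (v : ι → E) (e : ι → Bool) :
    ((stdGaussian E).prod (stdGaussian E)).map
        (fun x => WithLp.toLp 2 fun i => ⟪v i, if e i then x.1 else x.2⟫) =
      multivariateGaussian 0 (crossScale e (Matrix.of fun i j => ⟪v i, v j⟫) 0) := by
  have hm : Measurable (fun x : E × E =>
      (WithLp.toLp 2 fun i => ⟪v i, if e i then x.1 else x.2⟫ : EuclideanSpace ℝ ι)) := by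
    refine (WithLp.measurable_toLp _ _).comp (measurable_pi_lambda _ fun i => ?_)
    split_ifs <;> fun_prop
  have : IsProbabilityMeasure (((stdGaussian E).prod (stdGaussian E)).map
      (fun x => WithLp.toLp 2 fun i => ⟪v i, if e i then x.1 else x.2⟫)) :=
    Measure.isProbabilityMeasure_map hm.aemeasurable
  have hpsd : (crossScale e (Matrix.of fun i j => ⟪v i, v j⟫ : Matrix ι ι ℝ) 0).PosSemidef :=
    crossScale_posSemidef (t := 1) (by rw [crossScale_one]; exact posSemidef_gram v)
      le_rfl zero_le_one
  refine Measure.ext_of_charFun (funext fun t => ?_)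
  have hquad : t.ofLp ⬝ᵥ crossScale e (Matrix.of fun i j => ⟪v i, v j⟫) 0 *ᵥ t.ofLp =
      ‖∑ i, (if e i then t i else 0) • v i‖ ^ 2 + ‖∑ i, (if e i then 0 else t i) • v i‖ ^ 2 := by
    rw [← gram_quadratic, ← gram_quadratic]
    simp only [dotProduct, mulVec, crossScale, of_apply, ← Finset.sum_add_distrib, Finset.mul_sum]
    refine Finset.sum_congr rfl fun i _ => Finset.sum_congr rfl fun j _ => ?_
    cases e i <;> cases e j <;> simp
  rw [charFun_multivariateGaussian hpsd, hquad, charFun_apply,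
    integral_map hm.aemeasurable (Measurable.aestronglyMeasurable (by fun_prop))]
  have h : ∀ x : E × E, ⟪WithLp.toLp 2 fun i => ⟪v i, if e i then x.1 else x.2⟫, t⟫ =
      ⟪x.1, ∑ i, (if e i then t i else 0) • v i⟫ +
        ⟪x.2, ∑ i, (if e i then 0 else t i) • v i⟫ := by
    intro x
    simp only [PiLp.inner_apply, inner_sum, ← Finset.sum_add_distrib, real_inner_smul_right]
    refine Finset.sum_congr rfl fun i _ => ?_
    cases e i <;> simp [real_inner_comm, mul_comm]
  simp_rw [h, Complex.ofReal_add, add_mul, Complex.exp_add]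
  rw [integral_prod_mul (fun x : E => Complex.exp (⟪x, _⟫ * Complex.I))
    (fun x : E => Complex.exp (⟪x, _⟫ * Complex.I)), ← charFun_apply, ← charFun_apply,
    charFun_stdGaussian, charFun_stdGaussian, ← Complex.exp_add]
  simp; ring_nf

lemma stdGaussian_strips (v : ι → E) (e : ι → Bool) :
    stdGaussian E {x | ∀ i, e i = true → |⟪v i, x⟫| ≤ 1} *
        stdGaussian E {x | ∀ i, e i = false → |⟪v i, x⟫| ≤ 1} ≤
      stdGaussian E {x | ∀ i, |⟪v i, x⟫| ≤ 1} := by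
  have hmeas : MeasurableSet {x : EuclideanSpace ℝ ι | ∀ i, |x i| ≤ 1} := by
    rw [Set.ofPred_forall]
    exact MeasurableSet.iInter fun i => measurableSet_le (by fun_prop) measurable_const
  have h := multivariateGaussian_cube_le e (posSemidef_gram v)
  have hm : Measurable (fun x : E × E =>
      (WithLp.toLp 2 fun i => ⟪v i, if e i then x.1 else x.2⟫ : EuclideanSpace ℝ ι)) := by
    refine (WithLp.measurable_toLp _ _).comp (measurable_pi_lambda _ fun i => ?_)
    split_ifs <;> fun_prop
  rw [← map_inner_stdGaussian, ← map_inner_stdGaussian_prod, Measure.map_apply hm hmeas,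
    Measure.map_apply (by fun_prop) hmeas] at h
  rw [← Measure.prod_prod]
  refine le_trans (le_of_eq ?_) h
  congr 1
  ext x
  simp only [Set.mem_prod, Set.mem_ofPred_eq, Set.mem_preimage, ← forall_and]
  refine forall_congr' fun i => ?_
  cases e i <;> simp

end Strips

section Convex

open Filter Topology
open scoped RealInnerProductSpace

variable {E : Type*} [NormedAddCommGroup E] [InnerProductSpace ℝ E] [FiniteDimensional ℝ E]

omit [FiniteDimensional ℝ E] in
lemma zero_mem_of_convex_of_neg_mem {K : Set E} (hK : Convex ℝ K) (hs : ∀ x ∈ K, -x ∈ K)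
    (hne : K.Nonempty) : (0 : E) ∈ K := by
  obtain ⟨x, hx⟩ := hne
  have := hK hx (hs x hx) (a := 1 / 2) (b := 1 / 2) (by norm_num) (by norm_num) (by norm_num)
  simpa using this

/-- A nonempty symmetric closed convex set is a countable intersection of symmetric strips. -/
lemma exists_eq_setOf_abs_inner_le {K : Set E} (hc : IsClosed K) (hK : Convex ℝ K)
    (hs : ∀ x ∈ K, -x ∈ K) (hne : K.Nonempty) :
    ∃ v : ℕ → E, K = {x | ∀ n, |⟪v n, x⟫| ≤ 1} := by
  have h0 := zero_mem_of_convex_of_neg_mem hK hs hne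
  let I : Set E := {v | ∀ x ∈ K, |⟪v, x⟫| ≤ 1}
  obtain ⟨T, hTI, hTc, hTU⟩ := TopologicalSpace.isOpen_biUnion_countable I
    (fun v => {x | 1 < |⟪v, x⟫|}) fun v _ => isOpen_lt (by fun_prop) (by fun_prop)
  obtain ⟨v, hv⟩ := (hTc.insert 0).exists_eq_range (Set.insert_nonempty _ _)
  have hvI : ∀ n, v n ∈ I := fun n => by
    rcases (hv ▸ Set.mem_range_self n : v n ∈ insert 0 T) with h | h
    · rw [h]; intro x _; simp
    · exact hTI h
  refine ⟨v, Set.Subset.antisymm (fun x hx n => hvI n x hx) fun x hx => ?_⟩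
  by_contra hxK
  obtain ⟨f, u, hfu, hux⟩ := geometric_hahn_banach_closed_point hK hc hxK
  have hu : 0 < u := by simpa using hfu 0 h0
  let w : E := (InnerProductSpace.toDual ℝ E).symm (u⁻¹ • f)
  have hw : ∀ y, ⟪w, y⟫ = u⁻¹ * f y := fun y => by
    rw [InnerProductSpace.toDual_symm_apply]; simp
  have hwI : w ∈ I := fun y hy => by
    have h1 := hfu y hy
    have h2 := hfu (-y) (hs y hy)
    rw [map_neg] at h2
    rw [hw, abs_mul, abs_of_pos (inv_pos.2 hu), inv_mul_le_iff₀ hu, mul_one, abs_le]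
    constructor <;> linarith
  have hwx : 1 < |⟪w, x⟫| := by
    refine lt_of_lt_of_le ?_ (le_abs_self _)
    rw [hw, lt_inv_mul_iff₀ hu, mul_one]
    exact hux
  have hmem : x ∈ ⋃ v ∈ I, {x | 1 < |⟪v, x⟫|} := Set.mem_biUnion hwI hwx
  rw [← hTU] at hmem
  obtain ⟨z, hz, hzx⟩ := Set.mem_iUnion₂.1 hmem
  obtain ⟨n, rfl⟩ : z ∈ Set.range v := hv ▸ Set.mem_insert_of_mem _ hz
  exact absurd (hx n) (not_le.2 hzx)

variable [MeasurableSpace E] [BorelSpace E]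

lemma stdGaussian_mul_le_inter_of_isClosed {K L : Set E} (hKc : IsClosed K) (hLc : IsClosed L)
    (hK : Convex ℝ K) (hL : Convex ℝ L) (hKs : ∀ x ∈ K, -x ∈ K) (hLs : ∀ x ∈ L, -x ∈ L) :
    stdGaussian E K * stdGaussian E L ≤ stdGaussian E (K ∩ L) := by
  rcases K.eq_empty_or_nonempty with rfl | hKne
  · simp
  rcases L.eq_empty_or_nonempty with rfl | hLne
  · simp
  obtain ⟨v, rfl⟩ := exists_eq_setOf_abs_inner_le hKc hK hKs hKne
  obtain ⟨w, rfl⟩ := exists_eq_setOf_abs_inner_le hLc hL hLs hLne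
  let A : ℕ → Set E := fun N => {x | ∀ n : Fin N, |⟪v n, x⟫| ≤ 1 ∧ |⟪w n, x⟫| ≤ 1}
  have hA : {x | ∀ n, |⟪v n, x⟫| ≤ 1} ∩ {x | ∀ n, |⟪w n, x⟫| ≤ 1} = ⋂ N, A N := by
    ext x
    simp only [Set.mem_inter_iff, Set.mem_iInter, A, Set.mem_ofPred_eq, ← forall_and]
    exact ⟨fun h N n => h n, fun h n => h (n + 1) (Fin.last n)⟩
  have hAm : ∀ N, MeasurableSet (A N) := fun N => by
    simp only [A, Set.ofPred_forall]
    refine MeasurableSet.iInter fun i => MeasurableSet.inter (s₁ := {x | |⟪v i, x⟫| ≤ 1})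
      (s₂ := {x | |⟪w i, x⟫| ≤ 1}) ?_ ?_ <;>
    exact measurableSet_le (by fun_prop) measurable_const
  have hanti : Antitone A := fun M N h x hx n => hx (Fin.castLE h n)
  have hlim := tendsto_measure_iInter_atTop (μ := stdGaussian E)
    (fun N => (hAm N).nullMeasurableSet) hanti ⟨0, measure_ne_top _ _⟩
  rw [hA]
  refine ge_of_tendsto' hlim fun N => ?_
  have h := stdGaussian_strips
    (Sum.elim (fun n : Fin N => v n) fun n : Fin N => w n) Sum.isLeft
  refine le_trans (mul_le_mul' (measure_mono fun x hx => ?_) (measure_mono fun x hx => ?_))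
    (h.trans (measure_mono fun x hx => ?_))
  · rintro (n | n) hn
    · exact hx n
    · simp at hn
  · rintro (n | n) hn
    · simp at hn
    · exact hx n
  · exact fun n => ⟨hx (Sum.inl n), hx (Sum.inr n)⟩

lemma pi_absolutelyContinuous_pi : ∀ {n : ℕ} {μ ν : Fin n → Measure ℝ}
    [∀ i, SigmaFinite (μ i)] [∀ i, SigmaFinite (ν i)] (_ : ∀ i, μ i ≪ ν i),
    Measure.pi μ ≪ Measure.pi ν
  | 0, μ, ν, _, _, h => by
    rw [Measure.pi_of_empty, Measure.pi_of_empty]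
  | n + 1, μ, ν, _, _, h => by
    have h1 := measurePreserving_piFinSuccAbove μ 0
    have h2 := measurePreserving_piFinSuccAbove ν 0
    rw [← (h1.symm _).map_eq, ← (h2.symm _).map_eq]
    exact ((h 0).prod (pi_absolutelyContinuous_pi fun i => h _)).map
      (MeasurableEquiv.measurable _)

lemma stdGaussian_absolutelyContinuous {n : ℕ} :
    stdGaussian (EuclideanSpace ℝ (Fin n)) ≪ volume := by
  rw [← map_pi_eq_stdGaussian, ← (PiLp.volume_preserving_toLp (Fin n)).map_eq]
  exact (pi_absolutelyContinuous_pi fun _ =>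
    gaussianReal_absolutelyContinuous 0 one_ne_zero).map (by fun_prop)

end Convex

section Correlation

open Matrix Topology
open scoped MatrixOrder Matrix.Norms.L2Operator
open scoped RealInnerProductSpace

lemma stdGaussian_mul_le_inter {n : ℕ} {K L : Set (EuclideanSpace ℝ (Fin n))}
    (hK : Convex ℝ K) (hL : Convex ℝ L) (hKs : ∀ x ∈ K, -x ∈ K) (hLs : ∀ x ∈ L, -x ∈ L) :
    stdGaussian _ K * stdGaussian _ L ≤ stdGaussian _ (K ∩ L) := by
  have hfr : ∀ {A : Set (EuclideanSpace ℝ (Fin n))}, Convex ℝ A →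
      stdGaussian _ (frontier A) = 0 := fun hA =>
    stdGaussian_absolutelyContinuous (hA.addHaar_frontier volume)
  have hcl : ∀ {A : Set (EuclideanSpace ℝ (Fin n))}, (∀ x ∈ A, -x ∈ A) →
      ∀ x ∈ closure A, -x ∈ closure A := fun hA x hx =>
    map_mem_closure continuous_neg hx hA
  calc stdGaussian _ K * stdGaussian _ L
      ≤ stdGaussian _ (closure K) * stdGaussian _ (closure L) :=
        mul_le_mul' (measure_mono subset_closure) (measure_mono subset_closure)
    _ ≤ stdGaussian _ (closure K ∩ closure L) :=
        stdGaussian_mul_le_inter_of_isClosed isClosed_closure isClosed_closure hK.closure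
          hL.closure (hcl hKs) (hcl hLs)
    _ ≤ stdGaussian _ ((K ∩ L) ∪ (frontier K ∪ frontier L)) := by
        refine measure_mono fun x hx => ?_
        by_cases hxK : x ∈ K
        · by_cases hxL : x ∈ L
          · exact Or.inl ⟨hxK, hxL⟩
          · exact Or.inr (Or.inr ⟨hx.2, fun h => hxL (interior_subset h)⟩)
        · exact Or.inr (Or.inl ⟨hx.1, fun h => hxK (interior_subset h)⟩)
    _ ≤ stdGaussian _ (K ∩ L) := by
        refine (measure_union_le _ _).trans ?_
        rw [measure_union_null (hfr hK) (hfr hL), add_zero]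

lemma IsCenteredGaussian.exists_eq_multivariateGaussian {n : ℕ}
    {μ : Measure (EuclideanSpace ℝ (Fin n))} (hμ : IsCenteredGaussian μ) :
    ∃ S : Matrix (Fin n) (Fin n) ℝ, μ = multivariateGaussian 0 S := by
  obtain ⟨hprob, hmap⟩ := hμ
  have hG : IsGaussian μ := isGaussian_of_map_eq_gaussianReal fun L =>
    let ⟨v, hv⟩ := hmap L; ⟨0, v, hv⟩
  have hmean : μ[id] = 0 := by
    refine ext_inner_left ℝ fun x => ?_
    rw [inner_zero_right]
    obtain ⟨v, hv⟩ := hmap (innerSL ℝ x)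
    have h : ∫ y, innerSL ℝ x y ∂μ = 0 := by
      have := integral_id_gaussianReal (μ := 0) (v := v)
      rwa [← hv, integral_map (by fun_prop) (by fun_prop)] at this
    rw [← h, ContinuousLinearMap.integral_comp_comm _ IsGaussian.integrable_fun_id]
    simp
  let b := EuclideanSpace.basisFun (Fin n) ℝ
  let S : Matrix (Fin n) (Fin n) ℝ := .of fun i j => covarianceBilin μ (b i) (b j)
  have hS : ∀ x y : EuclideanSpace ℝ (Fin n), x.ofLp ⬝ᵥ S *ᵥ y.ofLp = covarianceBilin μ x y := by
    intro x y
    conv_rhs => rw [← b.sum_repr x, ← b.sum_repr y]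
    simp only [map_sum, _root_.sum_apply, map_smul, _root_.smul_apply,
      dotProduct, mulVec, S, of_apply, smul_eq_mul, Finset.mul_sum, b,
      EuclideanSpace.basisFun_repr]
    rw [Finset.sum_comm]
    exact Finset.sum_congr rfl fun i _ => Finset.sum_congr rfl fun j _ => by ring
  have hpsd : S.PosSemidef := by
    refine PosSemidef.of_dotProduct_mulVec_nonneg ?_ fun t => ?_
    · ext i j
      simp [S, covarianceBilin_comm (b i)]
    · have := hS (WithLp.toLp 2 t) (WithLp.toLp 2 t)
      rw [star_trivial, this]
      exact covarianceBilin_self_nonneg _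
  refine ⟨S, IsGaussian.ext ?_ ?_⟩
  · rw [hmean]; simp
  · ext x y
    rw [covarianceBilin_multivariateGaussian hpsd, hS]

/-- The Gaussian correlation inequality. -/
theorem IsCenteredGaussian.mul_le_inter {n : ℕ}
    {μ : Measure (EuclideanSpace ℝ (Fin n))} (hμ : IsCenteredGaussian μ)
    {K L : Set (EuclideanSpace ℝ (Fin n))} (hK : Convex ℝ K) (hL : Convex ℝ L)
    (hKs : ∀ x ∈ K, -x ∈ K) (hLs : ∀ x ∈ L, -x ∈ L) (hKm : MeasurableSet K)
    (hLm : MeasurableSet L) : μ K * μ L ≤ μ (K ∩ L) := by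
  obtain ⟨S, rfl⟩ := hμ.exists_eq_multivariateGaussian
  let T := toEuclideanCLM (𝕜 := ℝ) (CFC.sqrt S)
  have hT : multivariateGaussian 0 S = (stdGaussian _).map T := by
    simp [multivariateGaussian, T]
  have hTm : Measurable T := T.continuous.measurable
  rw [hT, Measure.map_apply hTm hKm, Measure.map_apply hTm hLm,
    Measure.map_apply hTm (hKm.inter hLm)]
  refine stdGaussian_mul_le_inter (hK.linear_preimage T.toLinearMap)
    (hL.linear_preimage T.toLinearMap) (fun x hx => ?_) fun x hx => ?_
  · rw [Set.mem_preimage, map_neg]; exact hKs _ hx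
  · rw [Set.mem_preimage, map_neg]; exact hLs _ hx

end Correlation

section Density

variable {α : Type*} [MeasurableSpace α] {k : ℕ} {f : Fin k → α → ℝ}

/-- Layer cake formula for a product of nonnegative functions. -/
lemma lintegral_ofReal_prod (μ : Measure α) [SFinite μ] (hf : ∀ i, Measurable (f i))
    (hf0 : ∀ i x, 0 ≤ f i x) :
    ∫⁻ x, ENNReal.ofReal (∏ i, f i x) ∂μ =
      ∫⁻ t : Fin k → ℝ, μ {x | ∀ i, 0 < t i ∧ t i ≤ f i x} := by
  have hS : MeasurableSet {p : α × (Fin k → ℝ) | ∀ i, 0 < p.2 i ∧ p.2 i ≤ f i p.1} := by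
    simp only [Set.ofPred_forall]
    refine MeasurableSet.iInter fun i => MeasurableSet.inter
      (s₁ := {p : α × (Fin k → ℝ) | 0 < p.2 i})
      (s₂ := {p : α × (Fin k → ℝ) | p.2 i ≤ f i p.1}) ?_ ?_
    · exact measurableSet_lt (by fun_prop) (by fun_prop)
    · exact measurableSet_le (by fun_prop) (by fun_prop)
  have h := (Measure.prod_apply hS (μ := μ) (ν := volume)).symm.trans
    (Measure.prod_apply_symm hS)
  refine Eq.trans (lintegral_congr fun x => ?_) h
  rw [ENNReal.ofReal_prod_of_nonneg fun i _ => hf0 i x]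
  have hbox := Real.volume_pi_Ioc (a := fun _ : Fin k => 0) (b := fun i => f i x)
  simp only [sub_zero] at hbox
  rw [← hbox]
  congr 1
  ext t
  simp

end Density

/-- Let `μ` be a centered Gaussian measure on a finite-dimensional real
vector space and let `ν` be a probability measure whose Radon–Nikodym derivative `dν/dμ`
is a finite product of symmetric quasi-concave nonnegative measurable functions.  Then
(i) `ν(K) ≥ μ(K)` for every symmetric convex Borel set `K`, and (ii) `∫ g dν ≤ ∫ g dμ`
for every nonnegative symmetric convex `μ`-integrable function `g`. -/
theorem dominated_by_gaussian_of_quasiConcave_density {d k : ℕ}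
    (μ ν : Measure (EuclideanSpace ℝ (Fin d)))
    (hμ : IsCenteredGaussian μ) (hν : IsProbabilityMeasure ν)
    (f : Fin k → EuclideanSpace ℝ (Fin d) → ℝ)
    (hmeas : ∀ i, Measurable (f i))
    (hnonneg : ∀ i x, 0 ≤ f i x)
    (hsymm : ∀ i x, f i (-x) = f i x)
    (hqc : ∀ (i) (c : ℝ), Convex ℝ {x | c ≤ f i x})
    (hdensity : ν = μ.withDensity (fun x => ENNReal.ofReal (∏ i, f i x))) :
    (∀ K : Set (EuclideanSpace ℝ (Fin d)), Convex ℝ K → (∀ x ∈ K, -x ∈ K) →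
        MeasurableSet K → μ K ≤ ν K) ∧
    (∀ g : EuclideanSpace ℝ (Fin d) → ℝ, (∀ x, 0 ≤ g x) → (∀ x, g (-x) = g x) →
        ConvexOn ℝ Set.univ g → Integrable g μ →
        (∫⁻ x, ENNReal.ofReal (g x) ∂ν) ≤ ∫⁻ x, ENNReal.ofReal (g x) ∂μ) := by
  have hprob : IsProbabilityMeasure μ := hμ.1
  have key : ∀ K : Set (EuclideanSpace ℝ (Fin d)), Convex ℝ K → (∀ x ∈ K, -x ∈ K) →
      MeasurableSet K → μ K ≤ ν K := by
    intro K hK hKs hKm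
    have htot : ∫⁻ x, ENNReal.ofReal (∏ i, f i x) ∂μ = 1 := by
      rw [← setLIntegral_univ, ← withDensity_apply _ MeasurableSet.univ, ← hdensity, measure_univ]
    calc μ K = μ K * ∫⁻ x, ENNReal.ofReal (∏ i, f i x) ∂μ := by rw [htot, mul_one]
      _ = ∫⁻ t : Fin k → ℝ, μ K * μ {x | ∀ i, 0 < t i ∧ t i ≤ f i x} := by
        rw [lintegral_ofReal_prod μ hmeas hnonneg, lintegral_const_mul' _ _ (measure_ne_top _ _)]
      _ ≤ ∫⁻ t : Fin k → ℝ, μ.restrict K {x | ∀ i, 0 < t i ∧ t i ≤ f i x} := by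
        refine lintegral_mono fun t => ?_
        have hLm : MeasurableSet {x | ∀ i, 0 < t i ∧ t i ≤ f i x} := by
          simp only [Set.ofPred_forall]
          exact MeasurableSet.iInter fun i => (MeasurableSet.const _).inter
            (measurableSet_le measurable_const (hmeas i))
        rw [Measure.restrict_apply hLm, Set.inter_comm]
        refine hμ.mul_le_inter hK ?_ hKs (fun x hx i => ?_) hKm hLm
        · exact fun x hx y hy a b ha hb hab i =>
            ⟨(hx i).1, hqc i (t i) (hx i).2 (hy i).2 ha hb hab⟩
        · rw [hsymm]; exact hx i
      _ = ν K := by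
        rw [← lintegral_ofReal_prod _ hmeas hnonneg, hdensity, withDensity_apply _ hKm]
  refine ⟨key, fun g hg0 hgs hgc _ => ?_⟩
  have hgm : Measurable g := by
    refine Continuous.measurable ?_
    rw [← continuousOn_univ]
    exact hgc.continuousOn isOpen_univ
  have hg0' : ∀ m : Measure (EuclideanSpace ℝ (Fin d)), 0 ≤ᵐ[m] g := fun m => ae_of_all _ hg0
  rw [lintegral_eq_lintegral_meas_lt ν (hg0' ν) hgm.aemeasurable,
    lintegral_eq_lintegral_meas_lt μ (hg0' μ) hgm.aemeasurable]
  refine lintegral_mono fun t => ?_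
  have hm : MeasurableSet {x | g x ≤ t} := measurableSet_le hgm measurable_const
  have hcompl : {x | t < g x} = {x | g x ≤ t}ᶜ := by
    ext x; simp
  rw [hcompl, prob_compl_eq_one_sub hm, prob_compl_eq_one_sub hm]
  refine tsub_le_tsub_left (key _ ?_ (fun x hx => ?_) hm) _
  · simpa using hgc.convex_le t
  · rw [Set.mem_ofPred_eq, hgs]; exact hx

end
end

section
/- Let μ be a centered Gaussian measure on a finite-dimensional real vector space X and let Q : X → ℝ≥0 be a nonnegative quadratic form (Q(x) = b(x,x) for a symmetric bilinear form b with Q ≥ 0). Then the probability measure μ^{⟨Q⟩} defined by dμ^{⟨Q⟩}(x) = Z^{-1} e^{−Q(x)} dμ(x), with Z = ∫ e^{−Q} dμ, is again a centered Gaussian measure on X. -/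
open MeasureTheory ProbabilityTheory
open scoped NNReal ENNReal

noncomputable section

open Complex in
/-- The Fourier transform of a centered Gaussian measure weighted by `exp (-l²)`. The proof writes
`exp (-l²)` as the characteristic function of `gaussianReal 0 2` and exchanges integrals. -/
lemma integral_exp_neg_sq_smul_cexp {E : Type*} [NormedAddCommGroup E] [NormedSpace ℝ E]
    [MeasurableSpace E] [BorelSpace E] [SecondCountableTopology E] (μ : Measure E) [IsGaussian μ]
    (hμ : ∀ L : StrongDual ℝ E, μ[L] = 0) (l L : StrongDual ℝ E) :
    ∫ x, Real.exp (-(l x) ^ 2) • cexp (L x * I) ∂μ =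
      (√(2 * Real.pi * (2 : ℝ≥0)))⁻¹ * (Real.pi / (1 / 4 + Var[l; μ] / 2 : ℂ)) ^ (1 / 2 : ℂ) *
        cexp (-((Var[L; μ] - 2 * cov[L, l; μ] ^ 2 / (1 + 2 * Var[l; μ]) : ℝ) : ℂ) / 2) := by
  have hsq (x : E) : (Real.exp (-(l x) ^ 2) : ℂ) =
      ∫ ξ, cexp (l x * ξ * I) ∂gaussianReal 0 2 := by
    rw [← charFun_apply_real, charFun_gaussianReal]
    simp
  have hvar (ξ : ℝ) : Var[L + ξ • l; μ] =
      Var[L; μ] + 2 * ξ * cov[L, l; μ] + ξ ^ 2 * Var[l; μ] := by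
    have hL := IsGaussian.memLp_dual μ L 2 (by simp)
    have hl := IsGaussian.memLp_dual μ l 2 (by simp)
    rw [FunLike.coe_add, FunLike.coe_smul, variance_add hL (hl.const_smul ξ),
      covariance_smul_right, variance_smul]
    ring
  have hchar (ξ : ℝ) : ∫ x, cexp (l x * ξ * I) * cexp (L x * I) ∂μ =
      cexp (-(Var[L; μ] + 2 * ξ * cov[L, l; μ] + ξ ^ 2 * Var[l; μ] : ℝ) / 2) := by
    have h := IsGaussian.charFunDual_eq (μ := μ) (L + ξ • l)
    rw [integral_complex_ofReal, hμ, hvar, charFunDual_apply] at h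
    simp only [ofReal_zero, zero_mul, zero_sub] at h
    rw [neg_div, ← h]
    congr with x
    rw [← Complex.exp_add]
    congr 1
    simp
    ring
  have hVpos : 0 ≤ Var[l; μ] := variance_nonneg _ _
  have hre : (-(1 / 4 + Var[l; μ] / 2 : ℂ)).re < 0 := by
    norm_cast
    have : 0 < 1 / 4 + Var[l; μ] / 2 := by positivity
    norm_num
    linarith
  calc ∫ x, Real.exp (-(l x) ^ 2) • cexp (L x * I) ∂μ
      = ∫ x, ∫ ξ, cexp (l x * ξ * I) * cexp (L x * I) ∂gaussianReal 0 2 ∂μ := by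
        congr with x
        rw [integral_mul_const, ← hsq, real_smul]
    _ = ∫ ξ, ∫ x, cexp (l x * ξ * I) * cexp (L x * I) ∂μ ∂gaussianReal 0 2 := by
        refine integral_integral_swap (.of_bound (C := 1) ?_ (.of_forall fun p ↦ ?_))
        · exact Measurable.aestronglyMeasurable (by fun_prop)
        · simp [Function.uncurry, ← ofReal_mul, norm_exp_ofReal_mul_I]
    _ = ∫ ξ : ℝ, (√(2 * Real.pi * (2 : ℝ≥0)))⁻¹ * cexp (-(1 / 4 + Var[l; μ] / 2 : ℂ) * ξ ^ 2 +
          -(cov[L, l; μ] : ℂ) * ξ + -(Var[L; μ] : ℂ) / 2) := by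
        simp_rw [hchar, integral_gaussianReal_eq_integral_smul (two_ne_zero : (2 : ℝ≥0) ≠ 0),
          gaussianPDFReal, real_smul]
        congr with ξ
        push_cast
        rw [mul_assoc, ← Complex.exp_add]
        congr 2
        ring
    _ = _ := by
        rw [integral_const_mul, integral_cexp_quadratic hre, neg_neg, ← mul_assoc]
        congr 2
        have h4 : (1 / 4 + Var[l; μ] / 2 : ℂ) = (1 + 2 * Var[l; μ]) / 4 := by ring
        rw [h4]
        push_cast
        field_simp
        ring

lemma two_mul_cov_sq_div_le_variance {Ω : Type*} {mΩ : MeasurableSpace Ω} {μ : Measure Ω}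
    [IsFiniteMeasure μ] {X Y : Ω → ℝ} (hX : MemLp X 2 μ) (hY : MemLp Y 2 μ) :
    2 * cov[X, Y; μ] ^ 2 / (1 + 2 * Var[Y; μ]) ≤ Var[X; μ] := by
  have hY0 : 0 ≤ Var[Y; μ] := variance_nonneg _ _
  have hD : 0 < 1 + 2 * Var[Y; μ] := by positivity
  set c := 2 * cov[X, Y; μ] / (1 + 2 * Var[Y; μ]) with hc
  have h := variance_nonneg (X + (-c) • Y) μ
  rw [variance_add hX (hY.const_smul _), covariance_smul_right, variance_smul] at h
  have hc' : 2 * cov[X, Y; μ] = c * (1 + 2 * Var[Y; μ]) := by rw [hc]; field_simp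
  have : 2 * cov[X, Y; μ] ^ 2 / (1 + 2 * Var[Y; μ]) = c * cov[X, Y; μ] := by rw [hc]; ring
  rw [this]
  nlinarith [sq_nonneg c, congrArg (c * ·) hc']

lemma integrable_exp_of_nonpos {Ω : Type*} {mΩ : MeasurableSpace Ω} {μ : Measure Ω}
    [IsFiniteMeasure μ] {f : Ω → ℝ} (hf : Measurable f) (hf0 : ∀ x, f x ≤ 0) :
    Integrable (fun x ↦ Real.exp (f x)) μ :=
  .of_bound (C := 1) (by fun_prop) (.of_forall fun x ↦ by simpa using hf0 x)

section

variable {d : ℕ} {μ : Measure (EuclideanSpace ℝ (Fin d))}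

lemma IsCenteredGaussian.isGaussian (hμ : IsCenteredGaussian μ) : IsGaussian μ :=
  isGaussian_of_map_eq_gaussianReal fun L ↦ ⟨0, hμ.2 L⟩

lemma IsCenteredGaussian.integral_eq_zero (hμ : IsCenteredGaussian μ)
    (L : StrongDual ℝ (EuclideanSpace ℝ (Fin d))) : μ[L] = 0 := by
  obtain ⟨v, hv⟩ := hμ.2 L
  have h := integral_map (μ := μ) (φ := L) (f := id) (by fun_prop) (by fun_prop)
  rw [hv] at h
  simpa using h.symm

lemma IsCenteredGaussian.tilted_neg_sq (hμ : IsCenteredGaussian μ)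
    (l : StrongDual ℝ (EuclideanSpace ℝ (Fin d))) :
    IsCenteredGaussian (μ.tilted fun x ↦ -(l x) ^ 2) := by
  have := hμ.isGaussian
  have hint : Integrable (fun x ↦ Real.exp (-(l x) ^ 2)) μ :=
    integrable_exp_of_nonpos (by fun_prop) fun x ↦ by simpa using sq_nonneg (l x)
  have : IsProbabilityMeasure (μ.tilted fun x ↦ -(l x) ^ 2) := isProbabilityMeasure_tilted hint
  refine ⟨this, fun L ↦ ?_⟩
  have hL := IsGaussian.memLp_dual μ L 2 (by simp)
  have hl := IsGaussian.memLp_dual μ l 2 (by simp)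
  obtain ⟨v, hv⟩ := NNReal.canLift.prf _
    (sub_nonneg.2 (two_mul_cov_sq_div_le_variance hL hl))
  refine ⟨v, ?_⟩
  have : IsProbabilityMeasure ((μ.tilted fun x ↦ -(l x) ^ 2).map L) :=
    Measure.isProbabilityMeasure_map (by fun_prop)
  have hZ := integral_exp_neg_sq_smul_cexp μ hμ.integral_eq_zero l 0
  have hZ' : (∫ x, Real.exp (-(l x) ^ 2) ∂μ : ℂ) ≠ 0 := by
    rw [integral_complex_ofReal]
    exact_mod_cast (integral_exp_pos hint).ne'
  simp only [FunLike.coe_zero, Pi.zero_apply, Complex.ofReal_zero, zero_mul, Complex.exp_zero,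
    Complex.real_smul, mul_one, variance_zero, covariance_zero_left, ne_eq, OfNat.ofNat_ne_zero,
    not_false_eq_true, zero_pow, mul_zero, zero_div, sub_zero, neg_zero] at hZ
  refine Measure.ext_of_charFun (funext fun t ↦ ?_)
  rw [charFun_map_eq_charFunDual_smul, charFunDual_apply, integral_tilted, charFun_gaussianReal]
  simp_rw [div_eq_inv_mul, mul_smul]
  rw [integral_smul, integral_exp_neg_sq_smul_cexp μ hμ.integral_eq_zero, ← hZ,
    Complex.real_smul, FunLike.coe_smul, variance_smul, covariance_smul_left, Complex.ofReal_inv,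
    ← integral_complex_ofReal, inv_mul_cancel_left₀ hZ']
  congr 1
  simp [hv]
  ring

lemma IsCenteredGaussian.tilted_neg_sum_sq (hμ : IsCenteredGaussian μ) {ι : Type*}
    (s : Finset ι) (l : ι → StrongDual ℝ (EuclideanSpace ℝ (Fin d))) :
    IsCenteredGaussian (μ.tilted fun x ↦ -∑ i ∈ s, (l i x) ^ 2) := by
  classical
  have := hμ.1
  induction s using Finset.induction_on with
  | empty => simpa using hμ
  | insert a s ha ih =>
    convert ih.tilted_neg_sq (l a) using 1
    rw [tilted_tilted]
    · congr with x
      simp [Finset.sum_insert ha, add_comm]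
    · exact integrable_exp_of_nonpos (by fun_prop) fun x ↦ by
        simpa using Finset.sum_nonneg fun i _ ↦ sq_nonneg (l i x)

end

lemma exists_sum_sq_of_bilinForm_nonneg {E : Type*} [AddCommGroup E] [Module ℝ E]
    [FiniteDimensional ℝ E] (b : LinearMap.BilinForm ℝ E) (hb : b.IsSymm) (h0 : ∀ x, 0 ≤ b x x) :
    ∃ l : Fin (Module.finrank ℝ E) → E →ₗ[ℝ] ℝ, ∀ x, b x x = ∑ i, (l i x) ^ 2 := by
  have : Invertible (2 : ℝ) := invertibleOfNonzero two_ne_zero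
  obtain ⟨v, hv⟩ := LinearMap.BilinForm.exists_orthogonal_basis (LinearMap.BilinForm.isSymm_iff.1 hb)
  refine ⟨fun i ↦ √(b (v i) (v i)) • v.coord i, fun x ↦ ?_⟩
  have hx : b x x = b (∑ i, v.repr x i • v i) (∑ i, v.repr x i • v i) := by rw [v.sum_repr]
  rw [hx]
  simp only [map_sum, LinearMap.sum_apply, map_smul, LinearMap.smul_apply, smul_eq_mul,
    Module.Basis.coord_apply, mul_pow, Real.sq_sqrt (h0 _)]
  refine Finset.sum_congr rfl fun i _ ↦ ?_
  rw [Finset.sum_eq_single i]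
  · ring
  · intro j _ hj
    have : b (v j) (v i) = 0 := hv hj
    simp [this]
  · simp

lemma inv_lintegral_smul_withDensity_eq_tilted {Ω : Type*} {mΩ : MeasurableSpace Ω}
    {μ : Measure Ω} [NeZero μ] {f : Ω → ℝ} (hf : Integrable (fun x ↦ Real.exp (f x)) μ) :
    (∫⁻ x, ENNReal.ofReal (Real.exp (f x)) ∂μ)⁻¹ •
      μ.withDensity (fun x ↦ ENNReal.ofReal (Real.exp (f x))) = μ.tilted f := by
  have hpos := integral_exp_pos hf
  rw [← ofReal_integral_eq_lintegral_ofReal hf (.of_forall fun x ↦ (Real.exp_pos _).le),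
    ← withDensity_smul' _ _ (by simpa using hpos), Measure.tilted]
  congr with x
  rw [Pi.smul_apply, smul_eq_mul, ENNReal.ofReal_div_of_pos hpos, mul_comm, div_eq_mul_inv]

/-- Let `μ` be a centered Gaussian measure on a finite-dimensional real
vector space and `Q` a nonnegative quadratic form.  Then the normalized tilted measure
`dμ^{⟨Q⟩}(x) = Z⁻¹ e^{-Q(x)} dμ(x)` is again a centered Gaussian measure. -/
theorem tilted_gaussian_isCenteredGaussian {d : ℕ}
    (μ : Measure (EuclideanSpace ℝ (Fin d))) (hμ : IsCenteredGaussian μ)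
    (Q : EuclideanSpace ℝ (Fin d) → ℝ)
    (hQquad : ∃ b : EuclideanSpace ℝ (Fin d) →ₗ[ℝ] EuclideanSpace ℝ (Fin d) →ₗ[ℝ] ℝ,
      (∀ x y, b x y = b y x) ∧ ∀ x, Q x = b x x)
    (hQnonneg : ∀ x, 0 ≤ Q x) :
    IsCenteredGaussian
      ((∫⁻ x, ENNReal.ofReal (Real.exp (-Q x)) ∂μ)⁻¹ •
        μ.withDensity (fun x => ENNReal.ofReal (Real.exp (-Q x)))) := by
  obtain ⟨b, hb, hQ⟩ := hQquad
  obtain ⟨l, hl⟩ := exists_sum_sq_of_bilinForm_nonneg b ⟨hb⟩ fun x ↦ hQ x ▸ hQnonneg x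
  have hQl (x) : Q x = ∑ i, (LinearMap.toContinuousLinearMap (l i) x) ^ 2 := by
    simp [hQ, hl]
  have hμ1 := hμ.1
  have hmeas : Measurable Q := by
    rw [funext hQl]
    fun_prop
  rw [inv_lintegral_smul_withDensity_eq_tilted
    (integrable_exp_of_nonpos (by fun_prop) fun x ↦ neg_nonpos.2 (hQnonneg x))]
  simp_rw [hQl]
  exact hμ.tilted_neg_sum_sq _ _

end
end

section
/- Let A, R > 0 satisfy A > 1/R. Then the function r ↦ V_A(r) + r²/(2R³) is monotone non-increasing on the interval [0, R]. -/
noncomputable section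

/-- The cut-off potential `V_A`: `V_A(r) = 2A - A²r` for `r ∈ [0, 1/A]` and
`V_A(r) = 1/r` for `r ≥ 1/A`. -/
def cutoffPotential (A : ℝ) (r : ℝ) : ℝ :=
  if r ≤ 1 / A then 2 * A - A ^ 2 * r else 1 / r

theorem sub_div_sq_le_one_div_sub_one_div {a b R : ℝ} (ha : 0 < a) (hab : a ≤ b)
    (hbR : b ≤ R) : (b - a) / R ^ 2 ≤ 1 / a - 1 / b := by
  have hb : 0 < b := ha.trans_le hab
  rw [div_sub_div _ _ ha.ne' hb.ne', one_mul, mul_one]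
  exact div_le_div_of_nonneg_left (sub_nonneg.2 hab) (mul_pos ha hb) (by nlinarith)

theorem sub_div_sq_le_cutoffPotential_sub {A R x y : ℝ} (hA : 0 < A) (hR : 0 < R)
    (hAR : 1 / R < A) (hxy : x ≤ y) (hyR : y ≤ R) :
    (y - x) / R ^ 2 ≤ cutoffPotential A x - cutoffPotential A y := by
  have linear_bound : ∀ {u v : ℝ}, u ≤ v → (v - u) / R ^ 2 ≤ A ^ 2 * (v - u) := by
    intro u v huv
    have hsq : (1 / R) ^ 2 ≤ A ^ 2 := by gcongr
    calc (v - u) / R ^ 2 = (1 / R) ^ 2 * (v - u) := by ring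
      _ ≤ A ^ 2 * (v - u) := mul_le_mul_of_nonneg_right hsq (sub_nonneg.2 huv)
  have hc : 0 < 1 / A := one_div_pos.2 hA
  unfold cutoffPotential
  split_ifs with hx hy hy
  · linarith [linear_bound hxy]
  · have h₁ := linear_bound hx
    have h₂ := sub_div_sq_le_one_div_sub_one_div hc (not_le.1 hy).le hyR
    have h₃ : A ^ 2 * (1 / A - x) = A - A ^ 2 * x := by field_simp
    rw [one_div_one_div] at h₂
    have h₄ : (y - x) / R ^ 2 = (y - 1 / A) / R ^ 2 + (1 / A - x) / R ^ 2 := by ring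
    linarith
  · exact absurd (hxy.trans hy) hx
  · exact sub_div_sq_le_one_div_sub_one_div (hc.trans (not_le.1 hx)) hxy hyR

/-- For `A, R > 0` with `A > 1/R`, the function
`r ↦ V_A(r) + r²/(2R³)` is monotone non-increasing on `[0, R]`. -/
theorem cutoffPotential_add_quadratic_antitoneOn (A R : ℝ) (hA : 0 < A) (hR : 0 < R)
    (hAR : 1 / R < A) :
    AntitoneOn (fun r => cutoffPotential A r + r ^ 2 / (2 * R ^ 3)) (Set.Icc 0 R) := by
  rintro x ⟨-, hxR⟩ y ⟨-, hyR⟩ hxy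
  have hV := sub_div_sq_le_cutoffPotential_sub hA hR hAR hxy hyR
  have hquad : y ^ 2 / (2 * R ^ 3) - x ^ 2 / (2 * R ^ 3) ≤ (y - x) / R ^ 2 := by
    rw [← sub_div, div_le_div_iff₀ (by positivity) (by positivity)]
    have h : (y - x) * (x + y) ≤ (y - x) * (2 * R) :=
      mul_le_mul_of_nonneg_left (by linarith) (sub_nonneg.2 hxy)
    nlinarith [mul_le_mul_of_nonneg_right h (sq_nonneg R)]
  show cutoffPotential A y + _ ≤ cutoffPotential A x + _
  linarith

end
end

section
/- There exists an absolute constant C₀ ≥ 100 such that the following holds. Let μ be a centered Gaussian measure on a finite-dimensional real vector space X, and let K ⊆ X be a symmetric convex Borel set with μ(K) ≥ 1 − δ for some δ ≤ 0.1. Then there exist δ' ∈ [0, δ] and probability measures ν_good and ν_bad on X with μ = (1−δ')·ν_good + δ'·ν_bad such that: (i) ν_good is supported in the dilated set C₀·K; (ii) the Radon–Nikodym derivative dν_good/dμ exists and is a symmetric quasi-concave function; (iii) ν_bad is absolutely continuous with respect to the dilation μ^{×2}, and dν_bad/dμ^{×2} is a symmetric quasi-concave function. -/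
open MeasureTheory ProbabilityTheory
open scoped NNReal ENNReal Pointwise

noncomputable section

theorem measure_mul_measure_compl_three_smul_le {E : Type*} [NormedAddCommGroup E]
    [NormedSpace ℝ E] [SecondCountableTopology E] [MeasurableSpace E] [BorelSpace E]
    {μ : Measure E} [SFinite μ]
    (hrot : (μ.prod μ).map (ContinuousLinearMap.rotation (-(Real.pi / 4))) = μ.prod μ)
    {K : Set E} (hconv : Convex ℝ K) (hsymm : ∀ x ∈ K, -x ∈ K) (hK : MeasurableSet K) :
    μ K * μ ((3 : ℝ) • K)ᶜ ≤ μ Kᶜ ^ 2 := by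
  have hm : MeasurableSet ((3 : ℝ) • K)ᶜ := (hK.const_smul₀ 3).compl
  rw [← Measure.prod_prod, ← hrot,
    Measure.map_apply (by fun_prop) (hK.prod hm), pow_two, ← Measure.prod_prod]
  refine measure_mono ?_
  rintro ⟨x, y⟩ ⟨h1, h2⟩
  simp only [ContinuousLinearMap.rotation_apply, Real.cos_neg, Real.cos_pi_div_four, Real.sin_neg,
    Real.sin_pi_div_four, neg_neg] at h1 h2
  set s : ℝ := √2 / 2
  have hs : s * s = 1 / 2 := by
    have := Real.mul_self_sqrt (show (0 : ℝ) ≤ 2 by norm_num)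
    simp only [s]; linarith
  have hs0 : 0 < s := by positivity
  have hs1 : s ≤ 1 := by nlinarith
  have hzero : (0 : E) ∈ K := by
    simpa using hconv h1 (hsymm _ h1) (by norm_num : (0 : ℝ) ≤ 1 / 2)
      (by norm_num : (0 : ℝ) ≤ 1 / 2) (by norm_num)
  -- if `z ∈ K` and `w ∈ K` then `2 s z + w ∈ 3 K`
  have key : ∀ z ∈ K, ∀ w ∈ K, (2 * s) • z + w ∈ (3 : ℝ) • K := by
    intro z hz w hw
    rw [Set.mem_smul_set_iff_inv_smul_mem₀ (by norm_num)]
    have hz' : s • z ∈ K := by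
      simpa using hconv hz hzero hs0.le (by linarith : (0 : ℝ) ≤ 1 - s) (by ring)
    have := hconv hz' hw (by norm_num : (0 : ℝ) ≤ 2 / 3) (by norm_num : (0 : ℝ) ≤ 1 / 3)
      (by norm_num)
    convert! this using 1
    module
  refine ⟨fun hx => h2 ?_, fun hy => h2 ?_⟩
  · convert! key x hx _ (hsymm _ h1) using 1
    module
  · convert! key y hy _ h1 using 1
    module

theorem charFun_withDensity_exp_neg_mul_sq {V : Type*} [NormedAddCommGroup V]
    [InnerProductSpace ℝ V] [FiniteDimensional ℝ V] [MeasurableSpace V] [BorelSpace V]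
    {b : ℝ} (hb : 0 < b) :
    ∃ c : ℝ, 0 < c ∧ ∀ t : V,
      charFun ((volume : Measure V).withDensity
        (fun x => ENNReal.ofReal (c * Real.exp (-b * ‖x‖ ^ 2)))) t =
        Complex.exp (-‖t‖ ^ 2 / (4 * b)) := by
  have hpos : 0 < (Real.pi / b) ^ (Module.finrank ℝ V / 2 : ℝ) := by positivity
  refine ⟨((Real.pi / b) ^ (Module.finrank ℝ V / 2 : ℝ))⁻¹, by positivity, fun t => ?_⟩
  set c := (Real.pi / b) ^ (Module.finrank ℝ V / 2 : ℝ) with hc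
  have hcC : (c : ℂ) = (Real.pi / b : ℂ) ^ (Module.finrank ℝ V / 2 : ℂ) := by
    rw [hc, Complex.ofReal_cpow (by positivity)]; simp
  have := GaussianFourier.integral_cexp_neg_mul_sq_norm_add (V := V) (b := b) (by simpa using hb) Complex.I t
  rw [charFun_apply, integral_withDensity_eq_integral_toReal_smul (by fun_prop) (by simp)]
  have h2 : ∀ x : V, (ENNReal.ofReal (c⁻¹ * Real.exp (-b * ‖x‖ ^ 2))).toReal •
      Complex.exp (inner ℝ x t * Complex.I) =
      (c : ℂ)⁻¹ * Complex.exp (-b * ‖x‖ ^ 2 + Complex.I * inner ℝ t x) := by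
    intro x
    rw [ENNReal.toReal_ofReal (by positivity), Complex.real_smul, Complex.exp_add,
      real_inner_comm]
    push_cast
    ring_nf
  simp_rw [h2]
  rw [integral_const_mul, this, ← hcC, inv_mul_cancel_left₀ (by exact_mod_cast hpos.ne')]
  simp

theorem exists_stdGaussian_eq_withDensity_map_two_smul (V : Type*) [NormedAddCommGroup V]
    [InnerProductSpace ℝ V] [FiniteDimensional ℝ V] [MeasurableSpace V] [BorelSpace V] :
    stdGaussian V ≪ volume ∧ ∃ c : ℝ, 0 < c ∧
      stdGaussian V = ((stdGaussian V).map (fun x => (2 : ℝ) • x)).withDensity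
        (fun x => ENNReal.ofReal (c * Real.exp (-(3 / 8) * ‖x‖ ^ 2))) := by
  obtain ⟨c₁, hc₁, h₁⟩ := charFun_withDensity_exp_neg_mul_sq (V := V) (b := 1 / 2) (by norm_num)
  obtain ⟨c₂, hc₂, h₂⟩ := charFun_withDensity_exp_neg_mul_sq (V := V) (b := 1 / 8) (by norm_num)
  have hfin : ∀ c b : ℝ, 0 < b → IsFiniteMeasure ((volume : Measure V).withDensity
        (fun x => ENNReal.ofReal (c * Real.exp (-b * ‖x‖ ^ 2)))) := by
    intro c b hb
    refine isFiniteMeasure_withDensity_ofReal (Integrable.const_mul ?_ c).2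
    have := (GaussianFourier.integrable_cexp_neg_mul_sq_norm_add (V := V) (b := b) (by simpa using hb) 0 0).norm
    simpa [Complex.norm_exp, ← Complex.ofReal_pow] using this
  have := hfin c₁ (1 / 2) (by norm_num)
  have := hfin c₂ (1 / 8) (by norm_num)
  have e₁ : stdGaussian V = (volume : Measure V).withDensity
      (fun x => ENNReal.ofReal (c₁ * Real.exp (-(1 / 2) * ‖x‖ ^ 2))) := by
    apply Measure.ext_of_charFun
    ext t
    rw [h₁, charFun_stdGaussian]
    congr 1
    push_cast
    ring
  have e₂ : (stdGaussian V).map (fun x => (2 : ℝ) • x) = (volume : Measure V).withDensity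
      (fun x => ENNReal.ofReal (c₂ * Real.exp (-(1 / 8) * ‖x‖ ^ 2))) := by
    have : IsFiniteMeasure ((stdGaussian V).map (fun x => (2 : ℝ) • x)) :=
      Measure.isFiniteMeasure_map _ _
    apply Measure.ext_of_charFun
    ext t
    rw [h₂, charFun_map_smul, charFun_stdGaussian, norm_smul]
    congr 1
    push_cast
    norm_num
    ring
  refine ⟨e₁ ▸ withDensity_absolutelyContinuous _ _, c₁ / c₂, by positivity, ?_⟩
  rw [e₂, ← withDensity_mul _ (by fun_prop) (by fun_prop)]
  nth_rw 1 [e₁]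
  congr 1
  ext x
  rw [Pi.mul_apply, ← ENNReal.ofReal_mul (by positivity)]
  congr 1
  rw [mul_mul_mul_comm, ← Real.exp_add, mul_div_cancel₀ _ hc₂.ne']
  ring_nf

open scoped MatrixOrder in
theorem exists_map_stdGaussian_of_centered {d : ℕ} {μ : Measure (EuclideanSpace ℝ (Fin d))}
    [IsGaussian μ] (h0 : μ[id] = 0) :
    ∃ A : EuclideanSpace ℝ (Fin d) →L[ℝ] EuclideanSpace ℝ (Fin d),
      μ = (stdGaussian (EuclideanSpace ℝ (Fin d))).map A := by
  set b := (EuclideanSpace.basisFun (Fin d) ℝ).toBasis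
  set S := LinearMap.BilinForm.toMatrix b (covarianceBilin μ).toBilinForm
  have hS : S.PosSemidef :=
    (LinearMap.isPosSemidef_iff_posSemidef_toMatrix b).1
      (LinearMap.BilinForm.isPosSemidef_iff.1 isPosSemidef_covarianceBilin)
  refine ⟨Matrix.toEuclideanCLM (𝕜 := ℝ) (CFC.sqrt S), ?_⟩
  have : μ = multivariateGaussian 0 S := by
    apply IsGaussian.ext
    · rw [h0]; simp
    rw [← ContinuousLinearMap.toBilinForm_inj]
    refine LinearMap.BilinForm.ext_basis b fun i j => ?_
    rw [ContinuousLinearMap.toBilinForm_apply, ContinuousLinearMap.toBilinForm_apply,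
      covarianceBilin_multivariateGaussian hS]
    simp [S, b, LinearMap.BilinForm.toMatrix_apply]
  rw [this, multivariateGaussian]
  simp

theorem map_orthogonalProjection_stdGaussian {E : Type*} [NormedAddCommGroup E]
    [InnerProductSpace ℝ E] [FiniteDimensional ℝ E] [MeasurableSpace E] [BorelSpace E]
    (V : Submodule ℝ E) : (stdGaussian E).map V.orthogonalProjectionOnto = stdGaussian V := by
  apply Measure.ext_of_charFun
  ext t
  rw [charFun_apply, integral_map (by fun_prop) (by fun_prop)]
  simp_rw [Submodule.inner_orthogonalProjectionOnto_eq_of_mem_right]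
  rw [← charFun_apply, charFun_stdGaussian, charFun_stdGaussian, Submodule.coe_norm]

/-- A centered Gaussian measure is the image of a standard Gaussian under an injective map. -/
theorem exists_injective_map_stdGaussian {d : ℕ} {μ : Measure (EuclideanSpace ℝ (Fin d))}
    (hμ : IsCenteredGaussian μ) :
    ∃ (V : Submodule ℝ (EuclideanSpace ℝ (Fin d))) (B : V →L[ℝ] EuclideanSpace ℝ (Fin d)),
      Function.Injective B ∧ μ = (stdGaussian V).map B := by
  obtain ⟨hprob, hL⟩ := hμ
  have hG : IsGaussian μ := isGaussian_of_map_eq_gaussianReal fun L => ⟨0, hL L⟩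
  have h0 : μ[id] = 0 := by
    refine ext_inner_left ℝ fun v => ?_
    obtain ⟨s, hs⟩ := hL (innerSL ℝ v)
    have h1 : ∫ x, inner ℝ v x ∂μ = ∫ y, y ∂(μ.map (innerSL ℝ v)) := by
      rw [integral_map (by fun_prop) (by fun_prop)]
      rfl
    have h2 := integral_inner (𝕜 := ℝ) (IsGaussian.integrable_id (μ := μ)) v
    simp only [id] at h2 ⊢
    rw [← h2, h1, hs, integral_id_gaussianReal, inner_zero_right]
  obtain ⟨A, hA⟩ := exists_map_stdGaussian_of_centered h0
  refine ⟨(LinearMap.ker A.toLinearMap)ᗮ, A.comp (LinearMap.ker A.toLinearMap)ᗮ.subtypeL, ?_, ?_⟩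
  · rw [injective_iff_map_eq_zero]
    intro x hx
    have : (x : EuclideanSpace ℝ (Fin d)) ∈ LinearMap.ker A.toLinearMap := hx
    have := Submodule.inner_right_of_mem_orthogonal this x.2
    exact Subtype.ext (inner_self_eq_zero.1 this)
  · rw [← map_orthogonalProjection_stdGaussian, Measure.map_map (by fun_prop) (by fun_prop), hA]
    congr 1
    ext1 x
    have hx := Submodule.sub_starProjection_mem_orthogonal (K := (LinearMap.ker A.toLinearMap)ᗮ) x
    rw [Submodule.orthogonal_orthogonal] at hx
    have := LinearMap.mem_ker.1 hx
    rw [map_sub, sub_eq_zero] at this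
    exact this

theorem two_le_neg_log {δ : ℝ} (hδ : 0 < δ) (hδ' : δ ≤ 0.1) : 2 ≤ -Real.log δ := by
  rw [le_neg, Real.log_le_iff_le_exp hδ, Real.exp_neg]
  refine hδ'.trans ?_
  rw [le_inv_comm₀ (by norm_num) (Real.exp_pos _), show (2 : ℝ) = 1 + 1 by norm_num, Real.exp_add]
  have := Real.exp_one_lt_d9
  nlinarith [Real.exp_pos 1]

theorem lt_gaussianReal_tail {δ : ℝ} (hδ : 0 < δ) (hδ' : δ ≤ 0.1) :
    ENNReal.ofReal δ < gaussianReal 0 1 {y | √(-Real.log δ) / 2 ≤ |y|} := by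
  set L := -Real.log δ with hL
  have hL2 : 2 ≤ L := two_le_neg_log hδ hδ'
  set r := √L / 2 with hr
  have hr0 : 0 < r := by positivity
  have hr2 : r ^ 2 = L / 4 := by rw [hr, div_pow, Real.sq_sqrt (by linarith)]; norm_num
  set T := Set.Icc r (r + 1) ∪ Set.Icc (-(r + 1)) (-r) with hT
  have hTsub : T ⊆ {y | r ≤ |y|} := by
    rintro y (⟨h, -⟩ | ⟨-, h⟩)
    · exact h.trans (le_abs_self y)
    · exact (le_neg.1 h).trans (neg_le_abs y)
  have hvol : volume T = 2 := by
    rw [hT, measure_union _ measurableSet_Icc, Real.volume_Icc, Real.volume_Icc]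
    · norm_num
    · exact Set.disjoint_left.2 fun y h1 h2 => by linarith [h1.1, h2.2]
  have hpdf : ∀ y ∈ T, ENNReal.ofReal ((√(2 * Real.pi))⁻¹ * Real.exp (-(L / 4) - 1)) ≤
      gaussianPDF 0 1 y := by
    intro y hy
    rw [gaussianPDF, gaussianPDFReal]
    simp only [NNReal.coe_one, mul_one, sub_zero]
    gcongr
    have : |y| ≤ r + 1 := by
      rw [abs_le]
      rcases hy with ⟨h1, h2⟩ | ⟨h1, h2⟩ <;> constructor <;> linarith
    have h3 : y ^ 2 ≤ (r + 1) ^ 2 := sq_le_sq' (by linarith [neg_abs_le y])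
      (by linarith [le_abs_self y])
    nlinarith [sq_nonneg (r - 1)]
  refine lt_of_lt_of_le ?_ (measure_mono hTsub)
  rw [gaussianReal_apply _ one_ne_zero]
  have hTm : MeasurableSet T := measurableSet_Icc.union measurableSet_Icc
  refine lt_of_lt_of_le ?_ (setLIntegral_mono' hTm hpdf)
  rw [setLIntegral_const, hvol, show (2 : ℝ≥0∞) = ENNReal.ofReal 2 by simp,
    ← ENNReal.ofReal_mul (by positivity), ENNReal.ofReal_lt_ofReal_iff (by positivity)]
  have hδexp : δ = Real.exp (-L) := by rw [hL, neg_neg, Real.exp_log hδ]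
  have hsqrt : √(2 * Real.pi) < 2.6 := by
    rw [Real.sqrt_lt' (by norm_num)]
    have := Real.pi_lt_d2
    norm_num at this ⊢
    linarith
  have hsp : 0 < √(2 * Real.pi) := by positivity
  have he : 1.5 ≤ Real.exp (3 * L / 4 - 1) := by
    have := Real.add_one_le_exp (3 * L / 4 - 1)
    linarith
  rw [hδexp, show -(L / 4) - 1 = -L + (3 * L / 4 - 1) by ring, Real.exp_add]
  have h4 : 1 < (√(2 * Real.pi))⁻¹ * 2 * 1.5 := by
    rw [inv_mul_eq_div, div_mul_eq_mul_div, lt_div_iff₀ hsp]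
    linarith
  calc Real.exp (-L) < Real.exp (-L) * ((√(2 * Real.pi))⁻¹ * 2 * 1.5) :=
        lt_mul_of_one_lt_right (Real.exp_pos _) h4
    _ ≤ Real.exp (-L) * ((√(2 * Real.pi))⁻¹ * 2 * Real.exp (3 * L / 4 - 1)) := by gcongr
    _ = _ := by ring

theorem closedBall_subset_of_stdGaussian {V : Type*} [NormedAddCommGroup V]
    [InnerProductSpace ℝ V] [FiniteDimensional ℝ V] [MeasurableSpace V] [BorelSpace V]
    (hac : stdGaussian V ≪ volume)
    {K : Set V} (hconv : Convex ℝ K) (hsymm : ∀ x ∈ K, -x ∈ K)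
    {δ : ℝ} (hδ : 0 < δ) (hδ' : δ ≤ 0.1) (hle : ENNReal.ofReal (1 - δ) ≤ stdGaussian V K) :
    Metric.closedBall 0 (√(-Real.log δ) / 2) ⊆ K := by
  intro x hx
  by_contra hxK
  have hint : stdGaussian V (interior K) = stdGaussian V K := by
    refine le_antisymm (measure_mono interior_subset) ?_
    have hfr : stdGaussian V (frontier K) = 0 := hac (hconv.addHaar_frontier volume)
    calc stdGaussian V K ≤ stdGaussian V (interior K ∪ frontier K) := by
          refine measure_mono ?_
          rw [← closure_eq_interior_union_frontier]
          exact subset_closure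
      _ ≤ _ := (measure_union_le _ _).trans (by rw [hfr, add_zero])
  obtain ⟨f, hf⟩ := geometric_hahn_banach_open_point hconv.interior isOpen_interior
    (fun h => hxK (interior_subset h))
  have hne : (interior K).Nonempty := by
    refine nonempty_of_measure_ne_zero (μ := stdGaussian V) ?_
    rw [hint]
    refine (lt_of_lt_of_le ?_ hle).ne'
    rw [ENNReal.ofReal_pos]
    linarith
  have hsymm_int : ∀ y ∈ interior K, -y ∈ interior K := by
    have hKneg : -K = K := by
      ext y
      exact ⟨fun h => by simpa using hsymm _ h, fun h => hsymm _ h⟩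
    intro y hy
    have := (Homeomorph.neg V).preimage_interior K
    rw [Homeomorph.coe_neg, Set.neg_preimage, Set.neg_preimage, hKneg] at this
    rwa [← Set.mem_neg, this]
  have hfabs : ∀ y ∈ interior K, |f y| < f x := by
    intro y hy
    rw [abs_lt]
    have h1 := hf y hy
    have h2 := hf _ (hsymm_int y hy)
    rw [map_neg] at h2
    constructor <;> linarith
  obtain ⟨y₀, hy₀⟩ := hne
  have hfx : 0 < f x := (abs_nonneg _).trans_lt (hfabs y₀ hy₀)
  have hfn : 0 < ‖f‖ := norm_pos_iff.2 (by rintro rfl; simp at hfx)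
  set g := ‖f‖⁻¹ • f with hg
  have hgn : ‖g‖ = 1 := by rw [hg, norm_smul, norm_inv, norm_norm, inv_mul_cancel₀ hfn.ne']
  have hgmap : (stdGaussian V).map g = gaussianReal 0 1 := by
    rw [IsGaussian.map_eq_gaussianReal, integral_strongDual_stdGaussian,
      variance_dual_stdGaussian, hgn]
    simp
  have hsub : g ⁻¹' {y | √(-Real.log δ) / 2 ≤ |y|} ⊆ (interior K)ᶜ := by
    intro y hy hyK
    have h1 := hfabs y hyK
    have h2 : |g y| < g x := by
      simp only [hg, _root_.smul_apply, smul_eq_mul, abs_mul, abs_inv, abs_norm]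
      gcongr
    have h3 : g x ≤ ‖x‖ := by
      have := (le_abs_self _).trans (g.le_opNorm x)
      rwa [hgn, one_mul] at this
    have h4 : ‖x‖ ≤ √(-Real.log δ) / 2 := by simpa using hx
    exact absurd hy (not_le.2 (h2.trans_le (h3.trans h4)))
  have h5 := lt_gaussianReal_tail hδ hδ'
  rw [← hgmap, Measure.map_apply (by fun_prop) (measurableSet_le (by fun_prop) (by fun_prop))] at h5
  have h6 := h5.trans_le (measure_mono hsub)
  rw [prob_compl_eq_one_sub isOpen_interior.measurableSet, hint] at h6
  refine absurd (h6.trans_le (tsub_le_tsub_left hle 1)) ?_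
  rw [not_lt, ← ENNReal.ofReal_one, ← ENNReal.ofReal_sub _ (by linarith)]
  simp

theorem convex_setOf_comp_infDist_le {V : Type*} [SeminormedAddCommGroup V] [NormedSpace ℝ V]
    {A : Set V} (hA : Convex ℝ A) (hne : A.Nonempty) {g : ℝ → ℝ} (hg : MonotoneOn g (Set.Ici 0))
    (t : ℝ) : Convex ℝ {x | g (Metric.infDist x A) ≤ t} := by
  have hmem : ∀ r, 0 ≤ r → ∀ x : V, x ∈ Metric.cthickening r A ↔ Metric.infDist x A ≤ r := by
    intro r hr x
    rw [Metric.mem_cthickening_iff, Metric.infDist,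
      ENNReal.le_ofReal_iff_toReal_le (Metric.infEDist_ne_top hne) hr]
  intro x hx y hy a b ha hb hab
  set r := max (Metric.infDist x A) (Metric.infDist y A) with hr
  have hr0 : 0 ≤ r := Metric.infDist_nonneg.trans (le_max_left _ _)
  have h := (hA.cthickening r) ((hmem r hr0 x).2 (le_max_left _ _))
    ((hmem r hr0 y).2 (le_max_right _ _)) ha hb hab
  refine (hg Metric.infDist_nonneg hr0 ((hmem r hr0 _).1 h)).trans ?_
  rcases max_choice (Metric.infDist x A) (Metric.infDist y A) with h' | h' <;> rw [hr, h']
  exacts [hx, hy]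

theorem convex_setOf_norm_sq_sub_infDist_sq_le {V : Type*} [NormedAddCommGroup V]
    [InnerProductSpace ℝ V] {A : Set V} (hne : A.Nonempty) (t : ℝ) :
    Convex ℝ {x | ‖x‖ ^ 2 - Metric.infDist x A ^ 2 ≤ t} := by
  have : {x | ‖x‖ ^ 2 - Metric.infDist x A ^ 2 ≤ t} =
      ⋂ k ∈ A, {x | 2 * inner ℝ k x ≤ t + ‖k‖ ^ 2} := by
    ext x
    simp only [Set.mem_ofPred_eq, Set.mem_iInter]
    have hd : ∀ k, 2 * inner ℝ k x ≤ t + ‖k‖ ^ 2 ↔ ‖x‖ ^ 2 - t ≤ dist x k ^ 2 := by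
      intro k
      rw [dist_eq_norm, norm_sub_sq_real, real_inner_comm]
      constructor <;> intro h <;> linarith
    simp_rw [hd]
    constructor
    · intro h k hk
      have := Metric.infDist_le_dist_of_mem (x := x) hk
      have := pow_le_pow_left₀ Metric.infDist_nonneg this 2
      linarith
    · intro h
      rw [sub_le_comm]
      refine Real.sqrt_le_left Metric.infDist_nonneg |>.1 ?_
      exact (Metric.le_infDist hne).2 fun {k} hk =>
        (Real.sqrt_le_left dist_nonneg).2 (h k hk)
  rw [this]
  refine convex_iInter₂ fun k _ => ?_
  exact convex_halfSpace_le
    (IsLinearMap.mk (fun x y => by rw [inner_add_right]; ring)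
      fun c x => by rw [inner_smul_right, smul_eq_mul]; ring) _

theorem convex_setOf_le_min_exp_mul_exp {V : Type*} [NormedAddCommGroup V]
    [InnerProductSpace ℝ V] {A : Set V} (hne : A.Nonempty) {b : ℝ} (hb : 0 < b) (a c : ℝ) :
    Convex ℝ {x | c ≤ min 1 (Real.exp (-a + b * Metric.infDist x A ^ 2)) *
      Real.exp (-b * ‖x‖ ^ 2)} := by
  rcases le_or_gt c 0 with hc | hc
  · convert! convex_univ
    exact Set.eq_univ_of_forall fun x => hc.trans (by positivity)
  have : {x : V | c ≤ min 1 (Real.exp (-a + b * Metric.infDist x A ^ 2)) *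
      Real.exp (-b * ‖x‖ ^ 2)} = {x | b * Metric.infDist x {0} ^ 2 ≤ -Real.log c} ∩
      {x | ‖x‖ ^ 2 - Metric.infDist x A ^ 2 ≤ (-a - Real.log c) / b} := by
    ext x
    rw [Set.mem_inter_iff, Set.mem_ofPred_eq, Set.mem_ofPred_eq, Set.mem_ofPred_eq,
      Metric.infDist_singleton, dist_zero_right, min_mul_of_nonneg _ _ (Real.exp_pos _).le,
      le_min_iff, one_mul, ← Real.exp_add, ← Real.log_le_iff_le_exp hc, ← Real.log_le_iff_le_exp hc,
      le_div_iff₀ hb]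
    refine and_congr ⟨fun h => ?_, fun h => ?_⟩ ⟨fun h => ?_, fun h => ?_⟩ <;> linarith
  rw [this]
  refine (convex_setOf_comp_infDist_le (g := fun t => b * t ^ 2) (convex_singleton 0)
    (Set.singleton_nonempty 0) ?_ _).inter (convex_setOf_norm_sq_sub_infDist_sq_le hne _)
  intro s hs t _ hst
  have : 0 ≤ s := hs
  dsimp only
  gcongr

theorem exists_cutoff_stdGaussian {V : Type*} [NormedAddCommGroup V]
    [InnerProductSpace ℝ V] [FiniteDimensional ℝ V] [MeasurableSpace V] [BorelSpace V]
    {K : Set V} (hconv : Convex ℝ K) (hsymm : ∀ x ∈ K, -x ∈ K) (hK : MeasurableSet K)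
    {δ : ℝ} (hδ : 0 < δ) (hδ' : δ ≤ 0.1) (hle : ENNReal.ofReal (1 - δ) ≤ stdGaussian V K) :
    ∃ H : V → ℝ, Continuous H ∧ (∀ x, 0 < H x) ∧ (∀ x, H x ≤ 1) ∧ (∀ x, H (-x) = H x) ∧
      (∀ t, Convex ℝ {x | H x ≤ t}) ∧
      (∀ c, Convex ℝ {x | c ≤ H x * Real.exp (-(3 / 8) * ‖x‖ ^ 2)}) ∧
      (∫ x, H x ∂stdGaussian V ≤ δ) ∧ ∀ x, H x < 1 → x ∈ (100 : ℝ) • K := by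
  have hball := closedBall_subset_of_stdGaussian
    (exists_stdGaussian_eq_withDensity_map_two_smul V).1 hconv hsymm hδ hδ' hle
  have hL2 := two_le_neg_log hδ hδ'
  set L := -Real.log δ with hL
  have h0 : (0 : V) ∈ K := hball (Metric.mem_closedBall_self (by positivity))
  have hne : ((3 : ℝ) • K).Nonempty := ⟨0, 0, h0, smul_zero _⟩
  set D : V → ℝ := fun x => Metric.infDist x ((3 : ℝ) • K) with hD
  have hDc : Continuous D := Metric.continuous_infDist_pt _
  have hDneg : ∀ x, D (-x) = D x := by
    intro x
    have h := Metric.infDist_image (LinearIsometryEquiv.neg ℝ (E := V)).isometry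
      (x := x) (t := (3 : ℝ) • K)
    have himg : (LinearIsometryEquiv.neg ℝ (E := V)) '' ((3 : ℝ) • K) = (3 : ℝ) • K := by
      ext y
      constructor
      · rintro ⟨_, ⟨z, hz, rfl⟩, rfl⟩
        exact ⟨-z, hsymm z hz, by simp⟩
      · rintro ⟨z, hz, rfl⟩
        exact ⟨_, ⟨-z, hsymm z hz, rfl⟩, by simp⟩
    rw [himg] at h
    exact h
  refine ⟨fun x => min 1 (Real.exp (-(2 * L) + 3 / 8 * D x ^ 2)), by fun_prop,
    fun x => by positivity, fun x => min_le_left _ _, fun x => by simp only [hDneg], ?_,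
    fun c => convex_setOf_le_min_exp_mul_exp hne (by norm_num) _ c, ?_, ?_⟩
  · refine convex_setOf_comp_infDist_le
      (g := fun t => min 1 (Real.exp (-(2 * L) + 3 / 8 * t ^ 2))) (hconv.smul 3) hne ?_
    intro s hs t _ hst
    have : 0 ≤ s := hs
    dsimp only
    gcongr
  · have hm : MeasurableSet ((3 : ℝ) • K)ᶜ := (hK.const_smul₀ 3).compl
    have hKreal : 1 - δ ≤ (stdGaussian V).real K :=
      (ENNReal.ofReal_le_iff_le_toReal (measure_ne_top _ _)).1 hle
    have hfer := measure_mul_measure_compl_three_smul_le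
      (IsGaussian.map_rotation_eq_self (μ := stdGaussian V) (by simp) _) hconv hsymm hK
    have hfer' : (stdGaussian V).real K * (stdGaussian V).real ((3 : ℝ) • K)ᶜ ≤
        (stdGaussian V).real Kᶜ ^ 2 := by
      have := ENNReal.toReal_mono (by finiteness) hfer
      simpa [Measure.real] using this
    have hcompl := probReal_compl_eq_one_sub (μ := stdGaussian V) hK
    have hcn : 0 ≤ (stdGaussian V).real Kᶜ := measureReal_nonneg
    set p := (stdGaussian V).real ((3 : ℝ) • K)ᶜ with hp
    have hp0 : 0 ≤ p := measureReal_nonneg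
    have hp1 : 0.9 * p ≤ δ ^ 2 := by
      calc 0.9 * p ≤ (stdGaussian V).real K * p := by gcongr; linarith
        _ ≤ _ := hfer'
        _ ≤ δ ^ 2 := by gcongr; linarith
    calc ∫ x, min 1 (Real.exp (-(2 * L) + 3 / 8 * D x ^ 2)) ∂stdGaussian V
        ≤ ∫ x, (δ ^ 2 + ((3 : ℝ) • K)ᶜ.indicator (fun _ => (1 : ℝ)) x) ∂stdGaussian V := by
          refine integral_mono_of_nonneg (Filter.Eventually.of_forall fun x => by positivity)
            ((integrable_const _).add ((integrable_const _).indicator hm))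
            (Filter.Eventually.of_forall fun x => ?_)
          by_cases hx : x ∈ (3 : ℝ) • K
          · have hDx : D x = 0 := Metric.infDist_zero_of_mem hx
            have : Real.exp (-(2 * L)) = δ ^ 2 := by
              rw [hL, show -(2 * -Real.log δ) = Real.log δ + Real.log δ by ring, Real.exp_add,
                Real.exp_log hδ, pow_two]
            simp [hx, hDx, this]
          · simp only [Set.mem_compl_iff, hx, not_false_eq_true, Set.indicator_of_mem]
            exact (min_le_left _ _).trans (by linarith [sq_nonneg δ])
      _ = δ ^ 2 + p := by
          rw [integral_add (integrable_const _) ((integrable_const _).indicator hm),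
            integral_indicator_const _ hm]
          simp [hp]
      _ ≤ δ := by nlinarith
  · intro x hx
    have h1 : Real.exp (-(2 * L) + 3 / 8 * D x ^ 2) < 1 := by simpa using hx
    rw [Real.exp_lt_one_iff] at h1
    have h2 : D x < 5 * (√L / 2) := by
      refine lt_of_pow_lt_pow_left₀ 2 (by positivity) ?_
      rw [mul_pow, div_pow, Real.sq_sqrt (by linarith)]
      linarith
    obtain ⟨_, ⟨k, hk, rfl⟩, hxk⟩ := (Metric.infDist_lt_iff hne).1 h2
    have hz : (1 / 5 : ℝ) • (x - (3 : ℝ) • k) ∈ K := by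
      refine hball ?_
      rw [mem_closedBall_zero_iff, norm_smul, ← dist_eq_norm]
      norm_num
      linarith
    rw [Set.mem_smul_set_iff_inv_smul_mem₀ (by norm_num)]
    have h8 := hconv hk hz (by norm_num : (0 : ℝ) ≤ 3 / 8) (by norm_num : (0 : ℝ) ≤ 5 / 8)
      (by norm_num)
    have := hconv h8 h0 (by norm_num : (0 : ℝ) ≤ 8 / 100) (by norm_num : (0 : ℝ) ≤ 92 / 100)
      (by norm_num)
    convert! this using 1
    module

theorem extend_zero_nonneg {V E : Type*} {f : V → ℝ} (B : V → E) (hf : ∀ x, 0 ≤ f x)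
    (x : E) :
    0 ≤ Function.extend B f 0 x := by
  classical
  by_cases h : ∃ v, B v = x
  · rw [Function.extend_def, dif_pos h]; exact hf _
  · rw [Function.extend_apply' _ _ _ h]; simp

theorem extend_zero_neg {V E : Type*} [AddCommGroup V] [Module ℝ V]
    [AddCommGroup E] [Module ℝ E] {B : V →ₗ[ℝ] E} {f : V → ℝ} (hB : Function.Injective B)
    (hf : ∀ x, f (-x) = f x) (x : E) :
    Function.extend B f 0 (-x) = Function.extend B f 0 x := by
  by_cases h : ∃ v, B v = x
  · obtain ⟨v, rfl⟩ := h
    rw [← map_neg, hB.extend_apply, hB.extend_apply, hf]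
  · rw [Function.extend_apply' _ _ _ h, Function.extend_apply' _ _ _ ?_]
    · simp
    · rintro ⟨v, hv⟩
      exact h ⟨-v, by rw [map_neg, hv, neg_neg]⟩

theorem convex_setOf_le_extend_zero {V E : Type*} [AddCommGroup V] [Module ℝ V]
    [AddCommGroup E] [Module ℝ E] {B : V →ₗ[ℝ] E} {f : V → ℝ}
    (hB : Function.Injective B) (hf0 : ∀ x, 0 ≤ f x)
    (hf : ∀ c, Convex ℝ {x | c ≤ f x}) (c : ℝ) :
    Convex ℝ {x | c ≤ Function.extend B f 0 x} := by
  rcases le_or_gt c 0 with hc | hc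
  · convert! convex_univ
    exact Set.eq_univ_of_forall fun x => hc.trans (extend_zero_nonneg B hf0 x)
  · convert! (hf c).linear_image B using 1
    ext x
    constructor
    · intro hx
      by_cases h : ∃ v, B v = x
      · obtain ⟨v, rfl⟩ := h
        rw [Set.mem_ofPred_eq, hB.extend_apply] at hx
        exact ⟨v, hx, rfl⟩
      · rw [Set.mem_ofPred_eq, Function.extend_apply' _ _ _ h] at hx
        exact absurd hx (not_le.2 hc)
    · rintro ⟨v, hv, rfl⟩
      rwa [Set.mem_ofPred_eq, hB.extend_apply]

theorem MeasurableEmbedding.map_withDensity_ofReal_eq_extend {V E : Type*} [MeasurableSpace V]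
    [MeasurableSpace E] {B : V → E} (hB : MeasurableEmbedding B) (γ : Measure V) (f : V → ℝ) :
    (γ.withDensity fun x => ENNReal.ofReal (f x)).map B =
      (γ.map B).withDensity fun x => ENNReal.ofReal (Function.extend B f 0 x) := by
  ext s hs
  rw [hB.map_apply, withDensity_apply _ (hB.measurable hs), withDensity_apply _ hs, hB.restrict_map,
    hB.lintegral_map]
  simp_rw [hB.injective.extend_apply]

/-- **good/bad decomposition.**  There is an absolute constant `C₀ ≥ 100`
such that: for any centered Gaussian measure `μ` on a finite-dimensional real vector space
and any symmetric convex Borel set `K` with `μ(K) ≥ 1 - δ` for some `δ ≤ 0.1`, one can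
write `μ = (1 - δ') ν_good + δ' ν_bad` with `0 ≤ δ' ≤ δ`, where `ν_good` is supported in
`C₀ K` and has a symmetric quasi-concave density w.r.t. `μ`, and `ν_bad` has a symmetric
quasi-concave density w.r.t. the dilation `μ^{×2}` (pushforward of `μ` under `x ↦ 2x`). -/
theorem gaussian_good_bad_decomposition :
    ∃ C₀ : ℝ, 100 ≤ C₀ ∧
      ∀ (d : ℕ) (μ : Measure (EuclideanSpace ℝ (Fin d))), IsCenteredGaussian μ →
        ∀ K : Set (EuclideanSpace ℝ (Fin d)),
          Convex ℝ K → (∀ x ∈ K, -x ∈ K) → MeasurableSet K →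
        ∀ δ : ℝ, 0 ≤ δ → δ ≤ 0.1 → ENNReal.ofReal (1 - δ) ≤ μ K →
        ∃ (δ' : ℝ) (νgood νbad : Measure (EuclideanSpace ℝ (Fin d))),
          0 ≤ δ' ∧ δ' ≤ δ ∧
          IsProbabilityMeasure νgood ∧ IsProbabilityMeasure νbad ∧
          μ = ENNReal.ofReal (1 - δ') • νgood + ENNReal.ofReal δ' • νbad ∧
          (∀ᵐ x ∂νgood, x ∈ C₀ • K) ∧
          (∃ f : EuclideanSpace ℝ (Fin d) → ℝ,
            (∀ x, 0 ≤ f x) ∧ (∀ x, f (-x) = f x) ∧ (∀ c : ℝ, Convex ℝ {x | c ≤ f x}) ∧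
            νgood = μ.withDensity (fun x => ENNReal.ofReal (f x))) ∧
          (∃ g : EuclideanSpace ℝ (Fin d) → ℝ,
            (∀ x, 0 ≤ g x) ∧ (∀ x, g (-x) = g x) ∧ (∀ c : ℝ, Convex ℝ {x | c ≤ g x}) ∧
            νbad = (μ.map (fun x => (2 : ℝ) • x)).withDensity
              (fun x => ENNReal.ofReal (g x))) := by
  refine ⟨100, le_rfl, fun d μ hμ K hconv hsymm hK δ hδ0 hδ hle => ?_⟩
  have hprob : IsProbabilityMeasure μ := hμ.1
  have hconst : ∀ c : ℝ, Convex ℝ {x : EuclideanSpace ℝ (Fin d) | c ≤ (1 : ℝ)} := fun c => by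
    by_cases h : c ≤ 1 <;> simp [h, convex_univ, convex_empty]
  rcases hδ0.eq_or_lt with rfl | hδpos
  · have hK1 : ∀ᵐ x ∂μ, x ∈ K := by
      rw [sub_zero, ENNReal.ofReal_one] at hle
      exact (mem_ae_iff_prob_eq_one hK).2 (le_antisymm prob_le_one hle)
    refine ⟨0, μ, μ.map (fun x => (2 : ℝ) • x), le_rfl, le_rfl, hprob,
      Measure.isProbabilityMeasure_map (by fun_prop), by simp, ?_,
      ⟨fun _ => 1, by simp, by simp, hconst, by simp⟩,
      ⟨fun _ => 1, by simp, by simp, hconst, by simp⟩⟩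
    filter_upwards [hK1] with x hx
    have h0 : (0 : EuclideanSpace ℝ (Fin d)) ∈ K := by
      simpa using hconv hx (hsymm _ hx) (by norm_num : (0 : ℝ) ≤ 1 / 2)
        (by norm_num : (0 : ℝ) ≤ 1 / 2) (by norm_num)
    rw [Set.mem_smul_set_iff_inv_smul_mem₀ (by norm_num)]
    have := hconv hx h0 (by norm_num : (0 : ℝ) ≤ 1 / 100) (by norm_num : (0 : ℝ) ≤ 99 / 100)
      (by norm_num)
    simpa using this
  obtain ⟨V, B, hBinj, hμB⟩ := exists_injective_map_stdGaussian hμ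
  set γ := stdGaussian V with hγ
  have hB : MeasurableEmbedding B :=
    (LinearMap.isClosedEmbedding_of_injective
      (f := B.toLinearMap) (LinearMap.ker_eq_bot.2 hBinj)).measurableEmbedding
  obtain ⟨H, hHc, hHpos, hH1, hHneg, hHle, hHexp, hHint, hHmem⟩ :=
    exists_cutoff_stdGaussian (K := B ⁻¹' K) (hconv.linear_preimage B.toLinearMap)
      (fun x hx => by simpa using hsymm _ hx) (hB.measurable hK) hδpos hδ
      (by rwa [hμB, hB.map_apply] at hle)
  have hHi : Integrable H γ := by
    refine Integrable.of_bound hHc.aestronglyMeasurable 1 (Filter.Eventually.of_forall fun x => ?_)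
    rw [Real.norm_of_nonneg (hHpos x).le]
    exact hH1 x
  set ε := ∫ x, H x ∂γ with hε
  have hεpos : 0 < ε := by
    rw [hε, integral_pos_iff_support_of_nonneg (fun x => (hHpos x).le) hHi,
      Function.support_eq_univ fun x => (hHpos x).ne']
    simp
  have hε1 : 0 < 1 - ε := by linarith
  obtain ⟨-, c, hc, hγ2⟩ := exists_stdGaussian_eq_withDensity_map_two_smul V
  rw [← hγ] at hγ2
  set f : V → ℝ := fun x => (1 - H x) / (1 - ε) with hf
  set h : V → ℝ := fun x => H x / ε with hh
  set g : V → ℝ := fun x => c / ε * (H x * Real.exp (-(3 / 8) * ‖x‖ ^ 2)) with hg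
  have hf0 : ∀ x, 0 ≤ f x := fun x => div_nonneg (by linarith [hH1 x]) hε1.le
  have hh0 : ∀ x, 0 ≤ h x := fun x => div_nonneg (hHpos x).le hεpos.le
  have hg0 : ∀ x, 0 ≤ g x := fun x => by have := hHpos x; positivity
  have hfi : Integrable f γ := ((integrable_const 1).sub hHi).div_const _
  have hhi : Integrable h γ := hHi.div_const _
  have hfprob : IsProbabilityMeasure (γ.withDensity fun x => ENNReal.ofReal (f x)) := by
    refine ⟨?_⟩
    rw [withDensity_apply _ .univ, Measure.restrict_univ,
      ← ofReal_integral_eq_lintegral_ofReal hfi (Filter.Eventually.of_forall hf0), hf,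
      integral_div, integral_sub (integrable_const _) hHi]
    simp [← hε, hε1.ne']
  have hhprob : IsProbabilityMeasure (γ.withDensity fun x => ENNReal.ofReal (h x)) := by
    refine ⟨?_⟩
    rw [withDensity_apply _ .univ, Measure.restrict_univ,
      ← ofReal_integral_eq_lintegral_ofReal hhi (Filter.Eventually.of_forall hh0), hh,
      integral_div, ← hε, div_self hεpos.ne', ENNReal.ofReal_one]
  have hfm : Measurable fun x => ENNReal.ofReal (f x) := by fun_prop
  have hhm : Measurable fun x => ENNReal.ofReal (h x) := by fun_prop
  have hgh : (γ.withDensity fun x => ENNReal.ofReal (h x)) =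
      (γ.map fun x => (2 : ℝ) • x).withDensity fun x => ENNReal.ofReal (g x) := by
    conv_lhs => rw [hγ2]
    rw [← withDensity_mul _ (by fun_prop) hhm]
    congr 1
    ext x
    rw [Pi.mul_apply, ← ENNReal.ofReal_mul (by positivity)]
    congr 1
    simp only [hh, hg]
    ring
  have hmap2 : μ.map (fun x => (2 : ℝ) • x) = (γ.map fun x => (2 : ℝ) • x).map B := by
    rw [hμB, Measure.map_map (by fun_prop) (by fun_prop),
      Measure.map_map (by fun_prop) (by fun_prop)]
    congr 1
    ext1 x
    simp
  refine ⟨ε, (γ.withDensity fun x => ENNReal.ofReal (f x)).map B,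
    (γ.withDensity fun x => ENNReal.ofReal (h x)).map B, hεpos.le, hHint,
    Measure.isProbabilityMeasure_map (by fun_prop),
    Measure.isProbabilityMeasure_map (by fun_prop), ?_, ?_,
    ⟨Function.extend B f 0, extend_zero_nonneg B hf0,
      extend_zero_neg (B := B.toLinearMap) hBinj fun x => by simp only [hf, hHneg],
      convex_setOf_le_extend_zero (B := B.toLinearMap) hBinj hf0 fun t => ?_, ?_⟩,
    ⟨Function.extend B g 0, extend_zero_nonneg B hg0,
      extend_zero_neg (B := B.toLinearMap) hBinj fun x => by simp only [hg, hHneg, norm_neg],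
      convex_setOf_le_extend_zero (B := B.toLinearMap) hBinj hg0 fun t => ?_, ?_⟩⟩
  · rw [← Measure.map_smul, ← Measure.map_smul, ← Measure.map_add _ _ hB.measurable, hμB]
    congr 1
    rw [← withDensity_smul _ hfm, ← withDensity_smul _ hhm,
      ← withDensity_add_left (hfm.const_smul _)]
    convert! (withDensity_one (μ := γ)).symm
    ext x
    simp only [Pi.add_apply, Pi.smul_apply, smul_eq_mul, Pi.one_apply]
    rw [← ENNReal.ofReal_mul hε1.le, ← ENNReal.ofReal_mul hεpos.le,
      ← ENNReal.ofReal_add (mul_nonneg hε1.le (hf0 x)) (mul_nonneg hεpos.le (hh0 x)), hf, hh,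
      mul_div_cancel₀ _ hε1.ne', mul_div_cancel₀ _ hεpos.ne']
    simp
  · rw [hB.ae_map_iff, ae_withDensity_iff hfm]
    refine Filter.Eventually.of_forall fun x hx => ?_
    have hx1 : H x < 1 := by
      by_contra hcon
      have : H x = 1 := le_antisymm (hH1 x) (not_lt.1 hcon)
      simp [hf, this] at hx
    obtain ⟨y, hy, rfl⟩ := hHmem x hx1
    exact ⟨B y, hy, by simp⟩
  · convert! hHle (1 - t * (1 - ε)) using 1
    ext x
    simp only [Set.mem_ofPred_eq, hf, le_div_iff₀ hε1]
    constructor <;> intro h <;> linarith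
  · rw [hB.map_withDensity_ofReal_eq_extend, hμB]
  · convert! hHexp (t / (c / ε)) using 1
    ext x
    simp only [Set.mem_ofPred_eq, hg]
    rw [div_le_iff₀' (by positivity)]
  · rw [hmap2, hgh, hB.map_withDensity_ofReal_eq_extend]

end
end

section
/- There exists an absolute constant c > 0 such that for every n ≥ 1, every δ ∈ (0, 0.1], and every closed symmetric convex set K ⊆ ℝⁿ with γ_n(K) ≥ 1 − δ, where γ_n is the standard Gaussian measure on ℝⁿ, the closed Euclidean ball of radius c·√(log(1/δ)) centered at the origin is contained in K. -/
open MeasureTheory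

noncomputable section

/-- The standard Gaussian measure on `ℝⁿ`, with density
`(2π)^{-n/2} e^{-‖x‖²/2}` with respect to Lebesgue measure. -/
def stdGaussian (n : ℕ) : Measure (EuclideanSpace ℝ (Fin n)) :=
  volume.withDensity fun x =>
    ENNReal.ofReal ((2 * Real.pi) ^ (-(n : ℝ) / 2) * Real.exp (-‖x‖ ^ 2 / 2))

theorem isProbabilityMeasure_stdGaussian (n : ℕ) : IsProbabilityMeasure (stdGaussian n) := by
  constructor
  have hint : Integrable
      (fun x : EuclideanSpace ℝ (Fin n) => Real.exp (-(1 / 2) * ‖x‖ ^ 2)) := by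
    have h := (GaussianFourier.integrable_cexp_neg_mul_sq_norm_add (b := (1 / 2 : ℂ))
      (by norm_num) 0 (0 : EuclideanSpace ℝ (Fin n))).norm
    refine h.congr (ae_of_all _ fun x => ?_)
    simp only [Complex.norm_exp]
    congr 1
    rw [show (-(1 / 2) * (‖x‖ : ℂ) ^ 2 + 0 * ((inner ℝ (0 : EuclideanSpace ℝ (Fin n)) x : ℝ) : ℂ))
      = ((-(1 / 2) * ‖x‖ ^ 2 : ℝ) : ℂ) by push_cast; ring, Complex.ofReal_re]
  have hfun : ∀ x : EuclideanSpace ℝ (Fin n),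
      (2 * Real.pi) ^ (-(n : ℝ) / 2) * Real.exp (-‖x‖ ^ 2 / 2)
        = (2 * Real.pi) ^ (-(n : ℝ) / 2) * Real.exp (-(1 / 2) * ‖x‖ ^ 2) := fun x => by
    congr 2; ring
  rw [stdGaussian, withDensity_apply _ MeasurableSet.univ, Measure.restrict_univ]
  simp only [hfun]
  rw [← ofReal_integral_eq_lintegral_ofReal (hint.const_mul _)
    (ae_of_all _ fun x => by positivity), integral_const_mul,
    GaussianFourier.integral_rexp_neg_mul_sq_norm (by norm_num), finrank_euclideanSpace_fin,
    show Real.pi / (1 / 2) = 2 * Real.pi by ring, ← Real.rpow_add (by positivity)]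
  norm_num [neg_div]

theorem stdGaussian_eq_probabilityTheory_stdGaussian (n : ℕ) :
    stdGaussian n = ProbabilityTheory.stdGaussian (EuclideanSpace ℝ (Fin n)) := by
  have := isProbabilityMeasure_stdGaussian n
  apply Measure.ext_of_charFun
  ext t
  rw [ProbabilityTheory.charFun_stdGaussian, charFun_apply, stdGaussian,
    integral_withDensity_eq_integral_toReal_smul (by fun_prop) (by simp)]
  have hfun : ∀ x : EuclideanSpace ℝ (Fin n),
      (ENNReal.ofReal ((2 * Real.pi) ^ (-(n : ℝ) / 2) * Real.exp (-‖x‖ ^ 2 / 2))).toReal •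
        Complex.exp ((inner ℝ x t : ℝ) * Complex.I)
      = (((2 * Real.pi) ^ (-(n : ℝ) / 2) : ℝ) : ℂ) *
        Complex.exp (-(1 / 2) * (‖x‖ : ℂ) ^ 2 + Complex.I * (inner ℝ t x : ℝ)) := fun x => by
    rw [ENNReal.toReal_ofReal (by positivity), Complex.real_smul, Complex.ofReal_mul, mul_assoc,
      Complex.ofReal_exp, ← Complex.exp_add, real_inner_comm]
    congr 2
    push_cast
    ring
  simp only [hfun]
  rw [integral_const_mul, GaussianFourier.integral_cexp_neg_mul_sq_norm_add (by norm_num),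
    finrank_euclideanSpace_fin, ← mul_assoc,
    show (Real.pi : ℂ) / (1 / 2) = ((2 * Real.pi : ℝ) : ℂ) by push_cast; ring,
    show ((n : ℂ) / 2) = (((n : ℝ) / 2 : ℝ) : ℂ) by push_cast; ring,
    ← Complex.ofReal_cpow (by positivity), ← Complex.ofReal_mul, ← Real.rpow_add (by positivity)]
  rw [show -(n : ℝ) / 2 + (n : ℝ) / 2 = 0 by ring, Real.rpow_zero, Complex.ofReal_one, one_mul,
    Complex.I_sq]
  congr 1
  ring

theorem map_stdGaussian_eq_gaussianReal {n : ℕ} (f : StrongDual ℝ (EuclideanSpace ℝ (Fin n)))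
    (hf : ‖f‖ = 1) : (stdGaussian n).map f = ProbabilityTheory.gaussianReal 0 1 := by
  rw [stdGaussian_eq_probabilityTheory_stdGaussian,
    ProbabilityTheory.IsGaussian.map_eq_gaussianReal,
    ProbabilityTheory.variance_dual_stdGaussian,
    ProbabilityTheory.integral_strongDual_stdGaussian, hf]
  simp

theorem exp_le_gaussianReal_Ici {r : ℝ} (hr : 0 ≤ r) :
    ENNReal.ofReal (Real.exp (-((r + 1) ^ 2 / 2 + 1))) ≤
      ProbabilityTheory.gaussianReal 0 1 (Set.Ici r) := by
  have hpi : Real.exp (-1) ≤ (√(2 * Real.pi))⁻¹ := by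
    rw [Real.exp_neg]
    refine inv_anti₀ (by positivity) (Real.sqrt_le_iff.2 ⟨by positivity, ?_⟩)
    nlinarith [Real.pi_lt_d2, Real.exp_one_gt_d9]
  calc ENNReal.ofReal (Real.exp (-((r + 1) ^ 2 / 2 + 1)))
      = ∫⁻ _ in Set.Icc r (r + 1), ENNReal.ofReal (Real.exp (-((r + 1) ^ 2 / 2 + 1))) := by
        simp
    _ ≤ ∫⁻ x in Set.Icc r (r + 1), ProbabilityTheory.gaussianPDF 0 1 x := by
        refine setLIntegral_mono (ProbabilityTheory.measurable_gaussianPDF 0 1) fun x hx => ?_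
        refine ENNReal.ofReal_le_ofReal ?_
        rw [ProbabilityTheory.gaussianPDFReal, neg_add_rev, Real.exp_add]
        simp only [NNReal.coe_one, mul_one, sub_zero]
        refine mul_le_mul hpi (Real.exp_le_exp.2 ?_) (Real.exp_pos _).le (by positivity)
        nlinarith [hx.1, hx.2]
    _ ≤ ∫⁻ x in Set.Ici r, ProbabilityTheory.gaussianPDF 0 1 x :=
        lintegral_mono_set Set.Icc_subset_Ici_self
    _ = ProbabilityTheory.gaussianReal 0 1 (Set.Ici r) :=
        (ProbabilityTheory.gaussianReal_apply 0 one_ne_zero _).symm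

theorem lt_exp_of_le_one_tenth {δ : ℝ} (hδ : 0 < δ) (hδ' : δ ≤ 0.1) :
    δ < Real.exp (-((0.1 * √(Real.log (1 / δ)) + 1) ^ 2 / 2 + 1)) := by
  have hlog : 2 ≤ Real.log (1 / δ) := by
    rw [Real.le_log_iff_exp_le (by positivity), show (2 : ℝ) = 1 + 1 by norm_num, Real.exp_add]
    have : (10 : ℝ) ≤ 1 / δ := by
      rw [le_div_iff₀ hδ]; linarith
    nlinarith [Real.exp_one_lt_three, Real.exp_pos 1]
  have hsq := Real.sq_sqrt (show 0 ≤ Real.log (1 / δ) by linarith)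
  rw [← Real.log_lt_iff_lt_exp hδ]
  have hneg : Real.log δ = -Real.log (1 / δ) := by simp
  rw [hneg]
  nlinarith [sq_nonneg (√(Real.log (1 / δ)) - 1)]

/-- **in-radius of high-probability symmetric convex sets.**
There is an absolute constant `c > 0` such that for every `n ≥ 1`, every `δ ∈ (0, 0.1]`,
and every closed symmetric convex set `K ⊆ ℝⁿ` with `γ_n(K) ≥ 1 - δ`, the closed ball of
radius `c √(log(1/δ))` centered at the origin is contained in `K`. -/
theorem inradius_of_gaussian_high_probability_convex_set :
    ∃ c : ℝ, 0 < c ∧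
      ∀ n : ℕ, 1 ≤ n →
        ∀ δ : ℝ, 0 < δ → δ ≤ 0.1 →
          ∀ K : Set (EuclideanSpace ℝ (Fin n)),
            IsClosed K → Convex ℝ K → (∀ x ∈ K, -x ∈ K) →
            ENNReal.ofReal (1 - δ) ≤ stdGaussian n K →
            Metric.closedBall 0 (c * Real.sqrt (Real.log (1 / δ))) ⊆ K := by
  refine ⟨0.1, by norm_num, fun n _ δ hδ hδ' K hKc hK _ hγ x hx => ?_⟩
  by_contra hxK
  have := isProbabilityMeasure_stdGaussian n
  set r := 0.1 * Real.sqrt (Real.log (1 / δ)) with hr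
  rw [mem_closedBall_zero_iff] at hx
  obtain ⟨f, u, hfK, hfx⟩ := geometric_hahn_banach_closed_point hK hKc hxK
  have hne : K.Nonempty := by
    rw [Set.nonempty_iff_ne_empty]
    rintro rfl
    rw [measure_empty, nonpos_iff_eq_zero, ENNReal.ofReal_eq_zero] at hγ
    norm_num at hδ'
    linarith
  obtain ⟨k, hk⟩ := hne
  have hf0 : f ≠ 0 := by
    rintro rfl
    have := (hfK k hk).trans hfx
    simp at this
  have hfn : 0 < ‖f‖ := norm_pos_iff.2 hf0
  set g : StrongDual ℝ (EuclideanSpace ℝ (Fin n)) := ‖f‖⁻¹ • f with hg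
  have hgn : ‖g‖ = 1 := norm_smul_inv_norm hf0
  have hgx : g x ≤ r := calc
    g x ≤ ‖g x‖ := Real.le_norm_self _
    _ ≤ ‖g‖ * ‖x‖ := g.le_opNorm x
    _ ≤ r := by rw [hgn, one_mul]; exact hx
  have hgK : ∀ y ∈ K, g y < r := fun y hy => lt_of_lt_of_le
    (mul_lt_mul_of_pos_left ((hfK y hy).trans hfx) (inv_pos.2 hfn)) hgx
  have hmeas : MeasurableSet (g ⁻¹' Set.Ici r) := g.measurable measurableSet_Ici
  have hdisj : Disjoint K (g ⁻¹' Set.Ici r) :=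
    Set.disjoint_left.2 fun y hy hy' => (hgK y hy).not_ge hy'
  have htail : ENNReal.ofReal δ < stdGaussian n (g ⁻¹' Set.Ici r) := by
    rw [← Measure.map_apply g.measurable measurableSet_Ici,
      map_stdGaussian_eq_gaussianReal g hgn]
    exact ((ENNReal.ofReal_lt_ofReal_iff (Real.exp_pos _)).2
      (lt_exp_of_le_one_tenth hδ hδ')).trans_le
      (exp_le_gaussianReal_Ici (by positivity))
  have hlt : (1 : ENNReal) < 1 := calc
    1 = ENNReal.ofReal (1 - δ) + ENNReal.ofReal δ := by
        rw [← ENNReal.ofReal_add (by norm_num at hδ'; linarith) hδ.le]; simp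
    _ < stdGaussian n K + stdGaussian n (g ⁻¹' Set.Ici r) :=
        ENNReal.add_lt_add_of_le_of_lt ENNReal.ofReal_ne_top hγ htail
    _ = stdGaussian n (K ∪ g ⁻¹' Set.Ici r) := (measure_union hdisj hmeas).symm
    _ ≤ 1 := prob_le_one
  exact lt_irrefl _ hlt

end
end

section
/- Let K ⊆ ℝⁿ be a nonempty closed convex set and let C₁ ≥ 3. Let σ : [0,∞) → ℝ≥0 be a twice continuously differentiable non-increasing function such that σ is constant on [0,1], |σ'(r)| ≤ (r−1)/C₁ for all r ≥ 1, and |σ''(r)| ≤ 1/C₁ for all r ≥ 0. Then the function x ↦ σ(dist(x, K)) + (3/8)·‖x‖² is convex on ℝⁿ, where dist(x,K) denotes the Euclidean distance from x to K. -/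
noncomputable section

/-- The distance to a nonempty convex set is a convex function. -/
theorem convexOn_infDist {E : Type*} [SeminormedAddCommGroup E] [NormedSpace ℝ E] {K : Set E}
    (hne : K.Nonempty) (hK : Convex ℝ K) :
    ConvexOn ℝ Set.univ (fun x => Metric.infDist x K) := by
  refine ⟨convex_univ, fun x _ y _ a b ha hb hab => le_of_forall_pos_lt_add fun ε hε => ?_⟩
  obtain ⟨p, hp, hxp⟩ := (Metric.infDist_lt_iff hne).1 (lt_add_of_pos_right (Metric.infDist x K) hε)
  obtain ⟨q, hq, hyq⟩ := (Metric.infDist_lt_iff hne).1 (lt_add_of_pos_right (Metric.infDist y K) hε)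
  have hpq : dist (a • x + b • y) (a • p + b • q) ≤ a * dist x p + b * dist y q := by
    refine (dist_add_add_le _ _ _ _).trans ?_
    rw [dist_smul₀, dist_smul₀, Real.norm_of_nonneg ha, Real.norm_of_nonneg hb]
  refine (Metric.infDist_le_dist_of_mem (hK hp hq ha hb hab)).trans_lt (hpq.trans_lt ?_)
  obtain rfl : b = 1 - a := by linarith
  simp only [smul_eq_mul]
  rcases ha.eq_or_lt with rfl | ha'
  · linarith
  · nlinarith

/-- The squared norm minus the squared distance to a set is a supremum of affine functions, hence
convex. -/
theorem convexOn_norm_sq_sub_infDist_sq {E : Type*} [NormedAddCommGroup E] [InnerProductSpace ℝ E]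
    {K : Set E} (hne : K.Nonempty) :
    ConvexOn ℝ Set.univ (fun x => ‖x‖ ^ 2 - Metric.infDist x K ^ 2) := by
  refine ⟨convex_univ, fun x _ y _ a b ha hb hab => ?_⟩
  simp only [smul_eq_mul]
  rw [sub_le_comm, ← Real.sqrt_le_left Metric.infDist_nonneg, Metric.le_infDist hne]
  intro p hp
  rw [Real.sqrt_le_left dist_nonneg, dist_eq_norm, norm_sub_sq_real, inner_add_left,
    real_inner_smul_left, real_inner_smul_left]
  have hsq (w : E) : Metric.infDist w K ^ 2 ≤ ‖w‖ ^ 2 - 2 * inner ℝ w p + ‖p‖ ^ 2 := by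
    rw [← norm_sub_sq_real, ← dist_eq_norm]
    exact pow_le_pow_left₀ Metric.infDist_nonneg (Metric.infDist_le_dist_of_mem hp) 2
  have hx := mul_le_mul_of_nonneg_left (hsq x) ha
  have hy := mul_le_mul_of_nonneg_left (hsq y) hb
  obtain rfl : b = 1 - a := by linarith
  linarith

/-- If `σ` is `C²` on `[0, ∞)` with `σ' ≥ -c r` and `σ'' ≥ -c` on `(0, ∞)`, then
`σ + c r² / 2` is convex and nondecreasing on `[0, ∞)`. -/
theorem convexOn_and_monotoneOn_add_mul_sq {σ : ℝ → ℝ} {c : ℝ}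
    (hσ : ContDiffOn ℝ 2 σ (Set.Ici 0))
    (h₁ : ∀ r, 0 < r → -(c * r) ≤ derivWithin σ (Set.Ici 0) r)
    (h₂ : ∀ r, 0 < r → -c ≤ derivWithin (derivWithin σ (Set.Ici 0)) (Set.Ici 0) r) :
    ConvexOn ℝ (Set.Ici 0) (fun r => σ r + c / 2 * r ^ 2) ∧
      MonotoneOn (fun r => σ r + c / 2 * r ^ 2) (Set.Ici 0) := by
  have hdiff : DifferentiableOn ℝ σ (Set.Ici 0) := hσ.differentiableOn (by norm_num)
  have hdiff' : DifferentiableOn ℝ (derivWithin σ (Set.Ici 0)) (Set.Ici 0) :=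
    (hσ.derivWithin (m := 1) (uniqueDiffOn_Ici 0) (by norm_num)).differentiableOn (by norm_num)
  have hderiv (r : ℝ) (hr : 0 < r) : HasDerivAt (fun r => σ r + c / 2 * r ^ 2)
      (derivWithin σ (Set.Ici 0) r + c * r) r := by
    have h := ((hdiff r hr.le).hasDerivWithinAt.hasDerivAt (Ici_mem_nhds hr)).add
      ((hasDerivAt_pow 2 r).const_mul (c / 2))
    exact h.congr_deriv (by push_cast; ring)
  have hderiv' (r : ℝ) (hr : 0 < r) : HasDerivAt (fun r => derivWithin σ (Set.Ici 0) r + c * r)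
      (derivWithin (derivWithin σ (Set.Ici 0)) (Set.Ici 0) r + c) r := by
    have h := ((hdiff' r hr.le).hasDerivWithinAt.hasDerivAt (Ici_mem_nhds hr)).add
      ((hasDerivAt_id r).const_mul c)
    exact h.congr_deriv (by ring)
  have hcont : ContinuousOn (fun r => σ r + c / 2 * r ^ 2) (Set.Ici 0) :=
    hσ.continuousOn.add (by fun_prop)
  have hmono : MonotoneOn (fun r => derivWithin σ (Set.Ici 0) r + c * r) (Set.Ioi 0) := by
    refine monotoneOn_of_deriv_nonneg (convex_Ioi 0)
      (fun r hr => (hderiv' r hr).continuousAt.continuousWithinAt) ?_ ?_ <;> rw [interior_Ioi]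
    · exact fun r hr => (hderiv' r hr).differentiableAt.differentiableWithinAt
    · intro r hr
      rw [(hderiv' r hr).deriv]
      linarith [h₂ r hr]
  have hd : DifferentiableOn ℝ (fun r => σ r + c / 2 * r ^ 2) (interior (Set.Ici 0)) := by
    rw [interior_Ici]
    exact fun r hr => (hderiv r hr).differentiableAt.differentiableWithinAt
  constructor
  · refine MonotoneOn.convexOn_of_deriv (convex_Ici 0) hcont hd ?_
    rw [interior_Ici]
    exact hmono.congr fun r hr => (hderiv r hr).deriv.symm
  · refine monotoneOn_of_deriv_nonneg (convex_Ici 0) hcont hd ?_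
    rw [interior_Ici]
    intro r hr
    rw [(hderiv r hr).deriv]
    linarith [h₁ r hr]

/-- Let `K ⊆ ℝⁿ` be a nonempty closed convex set and `C₁ ≥ 3`.  Let
`σ : [0,∞) → ℝ≥0` be a `C²` non-increasing function which is constant on `[0,1]` and
satisfies `|σ'(r)| ≤ (r-1)/C₁` for `r ≥ 1` and `|σ''(r)| ≤ 1/C₁` for `r ≥ 0`.  Then
`x ↦ σ(dist(x,K)) + (3/8)‖x‖²` is convex on `ℝⁿ`. -/
theorem convexity_of_distance_bump (n : ℕ) (K : Set (EuclideanSpace ℝ (Fin n)))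
    (hKne : K.Nonempty) (hKclosed : IsClosed K) (hKconv : Convex ℝ K)
    (C₁ : ℝ) (hC₁ : 3 ≤ C₁) (σ : ℝ → ℝ)
    (hσ_smooth : ContDiffOn ℝ 2 σ (Set.Ici 0))
    (hσ_nonneg : ∀ r : ℝ, 0 ≤ r → 0 ≤ σ r)
    (hσ_anti : AntitoneOn σ (Set.Ici 0))
    (hσ_const : ∀ r ∈ Set.Icc (0 : ℝ) 1, σ r = σ 0)
    (hσ_deriv : ∀ r : ℝ, 1 ≤ r → |derivWithin σ (Set.Ici 0) r| ≤ (r - 1) / C₁)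
    (hσ_deriv2 : ∀ r : ℝ, 0 ≤ r →
      |derivWithin (derivWithin σ (Set.Ici 0)) (Set.Ici 0) r| ≤ 1 / C₁) :
    ConvexOn ℝ Set.univ
      (fun x : EuclideanSpace ℝ (Fin n) =>
        σ (Metric.infDist x K) + 3 / 8 * ‖x‖ ^ 2) := by
  have hC : 0 < C₁ := by linarith
  have h₁ (r : ℝ) (hr : 0 < r) : -(1 / C₁ * r) ≤ derivWithin σ (Set.Ici 0) r := by
    rcases lt_or_ge r 1 with hr1 | hr1
    · have hconst : σ =ᶠ[nhds r] fun _ => σ 0 :=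
        Filter.eventually_of_mem (Icc_mem_nhds hr hr1) hσ_const
      rw [derivWithin_of_mem_nhds (Ici_mem_nhds hr), hconst.deriv_eq, deriv_const,
        neg_nonpos]
      positivity
    · have h := neg_le_of_abs_le (hσ_deriv r hr1)
      have hle : (r - 1) / C₁ ≤ 1 / C₁ * r := by
        rw [one_div_mul_eq_div]
        gcongr
        linarith
      linarith
  obtain ⟨hconv, hmono⟩ := convexOn_and_monotoneOn_add_mul_sq hσ_smooth h₁
    fun r hr => neg_le_of_abs_le (hσ_deriv2 r hr.le)
  have hcomp : ConvexOn ℝ Set.univ (fun x : EuclideanSpace ℝ (Fin n) =>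
      σ (Metric.infDist x K) + 1 / C₁ / 2 * Metric.infDist x K ^ 2) := by
    have hdist := convexOn_infDist hKne hKconv
    refine ⟨convex_univ, fun x hx y hy a b ha hb hab => ?_⟩
    have hx0 : Metric.infDist x K ∈ Set.Ici 0 := Metric.infDist_nonneg
    have hy0 : Metric.infDist y K ∈ Set.Ici 0 := Metric.infDist_nonneg
    exact (hmono Metric.infDist_nonneg (convex_Ici 0 hx0 hy0 ha hb hab)
      (hdist.2 hx hy ha hb hab)).trans (hconv.2 hx0 hy0 ha hb hab)
  have hcoef : 0 ≤ 3 / 8 - 1 / C₁ / 2 := by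
    have : 1 / C₁ ≤ 1 / 3 := one_div_le_one_div_of_le (by norm_num) hC₁
    linarith
  have hnorm : ConvexOn ℝ Set.univ (fun x : EuclideanSpace ℝ (Fin n) => ‖x‖ ^ 2) :=
    convexOn_univ_norm.pow (fun _ _ => norm_nonneg _) 2
  refine ((hcomp.add ((convexOn_norm_sq_sub_infDist_sq hKne).smul
    (show 0 ≤ 1 / C₁ / 2 by positivity))).add (hnorm.smul hcoef)).congr fun x _ => ?_
  simp only [Pi.add_apply, smul_eq_mul]
  ring

end
end

section
/- Fix positive real constants c₀, c₁. There exist constants α₀ and C (depending only on c₀, c₁) such that the following holds for all α ≥ α₀. Define real sequences by R₁ = c₀·√(log α), β_k = α/(16e²·R_k³), and R_{k+1} = c₁·(log β_k)^{1/2}·β_k^{−1/4}. Then β_k ≥ 2 for all k ≥ 1 (so the recursion is well defined), and there exists a positive integer L ≤ C·log α such that R_L ≤ C·(log α)²/α and α⁴/(C·(log α)⁶) ≤ β_L ≤ C·α⁴/(log α)⁶. -/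
open Filter in
/-- Eventually `log (log α)` is small against `log α`, and `log α` exceeds any given bound. -/
lemma exists_forall_log_log_le_and_le_log (M : ℝ) :
    ∃ α₀ : ℝ, ∀ α : ℝ, α₀ ≤ α →
      0 < α ∧ M ≤ Real.log α ∧ Real.log (Real.log α) ≤ Real.log α / 12 := by
  have hlog : ∀ᶠ A : ℝ in atTop, Real.log A ≤ A / 12 := by
    filter_upwards [Real.isLittleO_log_id_atTop.bound (show (0 : ℝ) < 1 / 12 by norm_num),
      eventually_ge_atTop (0 : ℝ)] with A hA hA0
    rw [Real.norm_eq_abs, Real.norm_eq_abs, id, abs_of_nonneg hA0] at hA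
    linarith [le_abs_self (Real.log A)]
  exact eventually_atTop.1 ((eventually_gt_atTop 0).and
    ((Real.tendsto_log_atTop.eventually_ge_atTop M).and
      (Real.tendsto_log_atTop.eventually hlog)))

/-- The logarithm of `α / (16 e² (c s)³)`. -/
lemma log_div_mul_pow_three {α c s : ℝ} (hα : 0 < α) (hc : 0 < c) (hs : 0 < s) :
    Real.log (α / (16 * Real.exp 1 ^ 2 * (c * s) ^ 3)) =
      Real.log α - Real.log (16 * Real.exp 1 ^ 2 * c ^ 3) - 3 * Real.log s := by
  have he := Real.exp_pos 1
  have h : 16 * Real.exp 1 ^ 2 * (c * s) ^ 3 = (16 * Real.exp 1 ^ 2 * c ^ 3) * s ^ 3 := by ring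
  rw [h, Real.log_div hα.ne' (by positivity), Real.log_mul (by positivity) (by positivity),
    Real.log_pow]
  push_cast
  ring

/-- One step of the recursion `x ↦ A - a + (3/4) x - (3/2) log x`: it preserves the interval
`[A / 2, 5 A]` and contracts towards `4 A - 6 log A` up to a bounded error. -/
lemma log_recursion_step {A a x : ℝ} (hA : 100 + 12 * |a| ≤ A) (hlog : Real.log A ≤ A / 12)
    (hx₁ : A / 2 ≤ x) (hx₂ : x ≤ 5 * A) :
    A / 2 ≤ A - a + 3 / 4 * x - 3 / 2 * Real.log x ∧
    A - a + 3 / 4 * x - 3 / 2 * Real.log x ≤ 5 * A ∧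
    |A - a + 3 / 4 * x - 3 / 2 * Real.log x - (4 * A - 6 * Real.log A)| ≤
      3 / 4 * |x - (4 * A - 6 * Real.log A)| + (6 + |a|) := by
  have ha := abs_nonneg a
  have ha₁ := le_abs_self a
  have ha₂ := neg_abs_le a
  have hA0 : 0 < A := by linarith
  have hx0 : 0 < x := by linarith
  have hupper : Real.log x ≤ Real.log A + 4 := by
    have h := Real.log_le_log hx0 hx₂
    rw [Real.log_mul (by norm_num) hA0.ne'] at h
    linarith [Real.log_le_sub_one_of_pos (show (0 : ℝ) < 5 by norm_num)]
  have hlower : Real.log A - 1 ≤ Real.log x := by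
    have h := Real.log_le_log (by linarith) hx₁
    rw [Real.log_div hA0.ne' (by norm_num)] at h
    linarith [Real.log_le_sub_one_of_pos (show (0 : ℝ) < 2 by norm_num)]
  have hlog0 : 0 ≤ Real.log x := Real.log_nonneg (by linarith)
  refine ⟨by linarith, by linarith, ?_⟩
  rw [abs_le]
  have h₁ := le_abs_self (x - (4 * A - 6 * Real.log A))
  have h₂ := neg_abs_le (x - (4 * A - 6 * Real.log A))
  constructor <;> linarith

/-- Geometric decay beats a linear prefactor after linearly many steps. -/
lemma three_quarters_pow_mul_le {A : ℝ} {n : ℕ} (hn : 4 * A ≤ n) :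
    (3 / 4 : ℝ) ^ n * A ≤ 1 := by
  have h₁ : (3 / 4 : ℝ) ^ n ≤ Real.exp (-A) := by
    calc (3 / 4 : ℝ) ^ n ≤ Real.exp (-(1 / 4)) ^ n := by
          gcongr
          linarith [Real.add_one_le_exp (-(1 / 4 : ℝ))]
      _ = Real.exp (n * (-(1 / 4))) := (Real.exp_nat_mul _ _).symm
      _ ≤ Real.exp (-A) := Real.exp_le_exp.2 (by linarith)
  have h₂ : A ≤ Real.exp A := by linarith [Real.add_one_le_exp A]
  calc (3 / 4 : ℝ) ^ n * A ≤ (3 / 4 : ℝ) ^ n * Real.exp A := by gcongr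
    _ ≤ Real.exp (-A) * Real.exp A := by gcongr
    _ = 1 := by rw [← Real.exp_add]; simp

/-- Fix positive constants `c₀, c₁`.  There exist `α₀` and `C`
(depending only on `c₀, c₁`) such that for all `α ≥ α₀`: if the sequences `(R_k), (β_k)`
satisfy `R₁ = c₀ √(log α)`, `β_k = α/(16 e² R_k³)` and
`R_{k+1} = c₁ (log β_k)^{1/2} β_k^{-1/4}` for `k ≥ 1`, then `β_k ≥ 2` for all `k ≥ 1`,
and there is a positive integer `L ≤ C log α` with `R_L ≤ C (log α)²/α` and
`α⁴/(C (log α)⁶) ≤ β_L ≤ C α⁴/(log α)⁶`. -/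
theorem confinement_recursion_converges (c₀ c₁ : ℝ) (hc₀ : 0 < c₀) (hc₁ : 0 < c₁) :
    ∃ α₀ C : ℝ, 0 < C ∧
      ∀ α : ℝ, α₀ ≤ α →
        ∀ R β : ℕ → ℝ,
          R 1 = c₀ * Real.sqrt (Real.log α) →
          (∀ k : ℕ, 1 ≤ k → β k = α / (16 * Real.exp 1 ^ 2 * R k ^ 3)) →
          (∀ k : ℕ, 1 ≤ k →
            R (k + 1) = c₁ * Real.sqrt (Real.log (β k)) * β k ^ (-(1 : ℝ) / 4)) →
          (∀ k : ℕ, 1 ≤ k → 2 ≤ β k) ∧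
          ∃ L : ℕ, 1 ≤ L ∧ (L : ℝ) ≤ C * Real.log α ∧
            R L ≤ C * Real.log α ^ 2 / α ∧
            α ^ 4 / (C * Real.log α ^ 6) ≤ β L ∧
            β L ≤ C * α ^ 4 / Real.log α ^ 6 := by
  set a := Real.log (16 * Real.exp 1 ^ 2 * c₁ ^ 3)
  set b := Real.log (16 * Real.exp 1 ^ 2 * c₀ ^ 3)
  obtain ⟨α₀, hα₀⟩ := exists_forall_log_log_le_and_le_log (100 + 12 * |a| + 12 * |b|)
  set D := 5 + 4 * (6 + |a|) with hD
  refine ⟨α₀, Real.exp D + 6, by positivity, fun α hα R β hR₁ hβ hR => ?_⟩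
  obtain ⟨hα0, hM, hloglog⟩ := hα₀ α hα
  set A := Real.log α with hAdef
  have habs := abs_nonneg a
  have hbbs := abs_nonneg b
  have hb₁ := le_abs_self b
  have hb₂ := neg_abs_le b
  have hA0 : 0 < A := by linarith
  have hlogA : 0 ≤ Real.log A := Real.log_nonneg (by linarith)
  have hpos : ∀ k, 1 ≤ k → 0 < R k → 0 < β k := fun k hk h => by
    rw [hβ k hk]; positivity
  have hinv : ∀ n : ℕ, 0 < R (n + 1) ∧ A / 2 ≤ Real.log (β (n + 1)) ∧
      Real.log (β (n + 1)) ≤ 5 * A ∧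
      |Real.log (β (n + 1)) - (4 * A - 6 * Real.log A)| ≤
        (3 / 4) ^ n * (5 * A) + 4 * (6 + |a|) := by
    intro n
    induction n with
    | zero =>
      have hs : 0 < Real.sqrt A := Real.sqrt_pos.2 hA0
      have hx : Real.log (β 1) = A - b - 3 / 2 * Real.log A := by
        rw [hβ 1 le_rfl, hR₁, log_div_mul_pow_three hα0 hc₀ hs, Real.log_sqrt hA0.le]
        ring
      simp only [zero_add, pow_zero]
      refine ⟨by rw [hR₁]; positivity, by linarith, by linarith, ?_⟩
      rw [hx, abs_le]
      constructor <;> linarith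
    | succ n ih =>
      obtain ⟨hRn, hlo, hhi, hdist⟩ := ih
      have hβn := hpos (n + 1) (by omega) hRn
      have hx0 : 0 < Real.log (β (n + 1)) := by linarith
      have hs : 0 < Real.sqrt (Real.log (β (n + 1))) := Real.sqrt_pos.2 hx0
      have hp : 0 < β (n + 1) ^ (-(1 : ℝ) / 4) := Real.rpow_pos_of_pos hβn _
      have hR' := hR (n + 1) (by omega)
      have hx : Real.log (β (n + 1 + 1)) =
          A - a + 3 / 4 * Real.log (β (n + 1)) - 3 / 2 * Real.log (Real.log (β (n + 1))) := by
        rw [hβ (n + 1 + 1) (by omega), hR', mul_assoc c₁,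
          log_div_mul_pow_three hα0 hc₁ (mul_pos hs hp), Real.log_mul hs.ne' hp.ne',
          Real.log_sqrt hx0.le, Real.log_rpow hβn]
        ring
      obtain ⟨h₁, h₂, h₃⟩ :=
        log_recursion_step (a := a) (by linarith) hloglog hlo hhi
      rw [hx]
      refine ⟨by rw [hR']; positivity, h₁, h₂, h₃.trans ?_⟩
      rw [pow_succ]
      linarith
  refine ⟨fun k hk => ?_, ⌈4 * A⌉₊ + 1, by omega, ?_, ?_⟩
  · obtain ⟨n, rfl⟩ := Nat.exists_eq_add_of_le' hk
    obtain ⟨hRn, hlo, -, -⟩ := hinv n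
    have hβn := hpos (n + 1) hk hRn
    linarith [Real.log_le_sub_one_of_pos hβn]
  · have hceil := Nat.ceil_lt_add_one (show 0 ≤ 4 * A by linarith)
    have hexp : 0 ≤ Real.exp D * A := by positivity
    push_cast
    linarith
  · obtain ⟨hRL, -, -, hdist⟩ := hinv ⌈4 * A⌉₊
    have hpow := three_quarters_pow_mul_le (Nat.le_ceil (4 * A))
    set L := ⌈4 * A⌉₊ + 1
    have hβL := hpos L (by omega) hRL
    have hβeq := hβ L (by omega)
    have hD' : |Real.log (β L) - (4 * A - 6 * Real.log A)| ≤ D := by linarith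
    obtain ⟨hl, hu⟩ := abs_le.1 hD'
    have hmain : Real.exp (4 * A - 6 * Real.log A) = α ^ 4 / A ^ 6 := by
      have h₁ := Real.exp_nat_mul A 4
      have h₂ := Real.exp_nat_mul (Real.log A) 6
      push_cast at h₁ h₂
      rw [Real.exp_sub, h₁, h₂, Real.exp_log hA0, hAdef, Real.exp_log hα0]
    have hupper : β L ≤ Real.exp D * (α ^ 4 / A ^ 6) := by
      rw [← hmain, ← Real.exp_add, ← Real.log_le_iff_le_exp hβL]
      linarith
    have hlower : α ^ 4 / (Real.exp D * A ^ 6) ≤ β L := by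
      rw [mul_comm, ← div_div, ← hmain, ← Real.exp_sub, ← Real.le_log_iff_exp_le hβL]
      linarith
    refine ⟨?_, le_trans ?_ hlower, hupper.trans ?_⟩
    · have hE : 1 ≤ Real.exp D := Real.one_le_exp (by positivity)
      have he : 1 ≤ Real.exp 1 := Real.one_le_exp (by norm_num)
      have hcube : R L ^ 3 ≤ (Real.exp D * A ^ 2 / α) ^ 3 := by
        calc R L ^ 3 ≤ 16 * Real.exp 1 ^ 2 * R L ^ 3 :=
              le_mul_of_one_le_left (by positivity) (by nlinarith)
          _ = α / β L := by rw [hβeq]; field_simp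
          _ ≤ α / (α ^ 4 / (Real.exp D * A ^ 6)) := by gcongr
          _ = Real.exp D * (A ^ 6 / α ^ 3) := by field_simp
          _ ≤ Real.exp D ^ 3 * (A ^ 6 / α ^ 3) := by
              gcongr
              exact le_self_pow₀ hE (by norm_num)
          _ = (Real.exp D * A ^ 2 / α) ^ 3 := by field_simp
      refine (le_of_pow_le_pow_left₀ (by norm_num) (by positivity) hcube).trans ?_
      gcongr
      linarith
    · gcongr
      linarith
    · rw [mul_div_assoc]
      gcongr
      linarith
end
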